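/- Let Ω ⊂ ℝⁿ be a nonempty bounded open set. Suppose u ∈ W^{s,p(·,·)}(ℝⁿ) is a weak supersolution of (−Δ)^s_{p(·,·)}u = 0 in Ω and satisfies sup_{x∈Ω} ∫_{ℝⁿ} u₋(y)^{p(x,y)−1}(1+|y|^{n+s·p(x,y)})^{−1} dy < ∞. Then u is locally essentially bounded from below in Ω: for every x₀ ∈ Ω there exist r > 0 with B_r(x₀) ⊆ Ω and m > −∞ such that u ≥ m almost everywhere on B_r(x₀). -/

import Mathlib

open MeasureTheory Metric Set Filter
open scoped ENNReal Topology
noncomputable section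

/-- `ℝⁿ` with the Euclidean norm and Lebesgue measure. -/
abbrev Rn (n : ℕ) := EuclideanSpace ℝ (Fin n)

/-- `p₊(E × F) = sup_{x ∈ E, y ∈ F} p(x,y)`. -/
def pSup {n : ℕ} (p : Rn n → Rn n → ℝ) (E F : Set (Rn n)) : ℝ :=
  sSup (Set.image2 p E F)

/-- `p₋(E × F) = inf_{x ∈ E, y ∈ F} p(x,y)`. -/
def pInf {n : ℕ} (p : Rn n → Rn n → ℝ) (E F : Set (Rn n)) : ℝ :=
  sInf (Set.image2 p E F)

/-- Standing assumptions on the variable exponent: continuity, symmetry and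
`1 < inf p ≤ sup p < ∞`. -/
def ExponentOK {n : ℕ} (p : Rn n → Rn n → ℝ) : Prop :=
  Continuous (fun z : Rn n × Rn n => p z.1 z.2) ∧ (∀ x y, p x y = p y x) ∧
    ∃ pm pM : ℝ, 1 < pm ∧ ∀ x y, pm ≤ p x y ∧ p x y ≤ pM

/-- Membership in the fractional Sobolev space `W^{s,p(·,·)}(ℝⁿ)`. -/
def MemW {n : ℕ} (s : ℝ) (p : Rn n → Rn n → ℝ) (u : Rn n → ℝ) : Prop :=
  Measurable u ∧
    (∫⁻ x, ENNReal.ofReal (|u x| ^ p x x)) < ⊤ ∧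
    (∫⁻ x, ∫⁻ y, ENNReal.ofReal (|u x - u y| ^ p x y / ‖x - y‖ ^ ((n : ℝ) + s * p x y))) < ⊤

/-- Weak subsolution of `(-Δ)^s_{p(·,·)} u = 0` in `Ω`. -/
def IsWeakSubsol {n : ℕ} (s : ℝ) (p : Rn n → Rn n → ℝ) (Ω : Set (Rn n)) (u : Rn n → ℝ) : Prop :=
  ∀ φ : Rn n → ℝ, MemW s p φ → (∀ x, 0 ≤ φ x) → (∀ᵐ x, x ∉ Ω → φ x = 0) →
    (∫ x, ∫ y, |u x - u y| ^ (p x y - 2) * (u x - u y) * (φ x - φ y)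
      / ‖x - y‖ ^ ((n : ℝ) + s * p x y)) ≤ 0

/-- Weak supersolution of `(-Δ)^s_{p(·,·)} u = 0` in `Ω`. -/
def IsWeakSupersol {n : ℕ} (s : ℝ) (p : Rn n → Rn n → ℝ) (Ω : Set (Rn n)) (u : Rn n → ℝ) : Prop :=
  ∀ φ : Rn n → ℝ, MemW s p φ → (∀ x, 0 ≤ φ x) → (∀ᵐ x, x ∉ Ω → φ x = 0) →
    0 ≤ (∫ x, ∫ y, |u x - u y| ^ (p x y - 2) * (u x - u y) * (φ x - φ y)
      / ‖x - y‖ ^ ((n : ℝ) + s * p x y))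

/-- Weak solution of `(-Δ)^s_{p(·,·)} u = 0` in `Ω`. -/
def IsWeakSol {n : ℕ} (s : ℝ) (p : Rn n → Rn n → ℝ) (Ω : Set (Rn n)) (u : Rn n → ℝ) : Prop :=
  IsWeakSubsol s p Ω u ∧ IsWeakSupersol s p Ω u

/-- Condition (P1) in `Ω` with constant `L`. -/
def CondP1 {n : ℕ} (p : Rn n → Rn n → ℝ) (Ω : Set (Rn n)) (L : ℝ) : Prop :=
  ∀ (x₀ : Rn n) (R : ℝ), 0 < R → closedBall x₀ R ⊆ Ω →
    R ^ (pInf p (ball x₀ R) (ball x₀ R) - pSup p (ball x₀ R) (ball x₀ R)) ≤ L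

/-- Condition (P2) in `Ω`. -/
def CondP2 {n : ℕ} (p : Rn n → Rn n → ℝ) (Ω : Set (Rn n)) : Prop :=
  ∀ (x₀ : Rn n) (R : ℝ), 0 < R → closedBall x₀ R ⊆ Ω →
    pSup p (ball x₀ R) ((ball x₀ R)ᶜ) ≤ pSup p (ball x₀ R) (ball x₀ R) ∧
    pInf p (ball x₀ R) ((ball x₀ R)ᶜ) ≤ pInf p (ball x₀ R) (ball x₀ R)

lemma rpow_sub_one_mul_le {a b p : ℝ} (ha : 0 ≤ a) (hb : 0 ≤ b) (hp : 1 < p) :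
    a ^ (p - 1) * b ≤ a ^ p + b ^ p := by
  rcases ha.eq_or_lt with rfl | ha'
  · rw [Real.zero_rpow (by linarith), Real.zero_rpow (by linarith)]
    simpa using Real.rpow_nonneg hb p
  rcases le_total a b with h | h
  · rcases hb.eq_or_lt with rfl | hb'
    · linarith
    calc a ^ (p - 1) * b ≤ b ^ (p - 1) * b := by gcongr
      _ = b ^ p := by rw [← Real.rpow_add_one hb'.ne']; ring_nf
      _ ≤ _ := by linarith [Real.rpow_nonneg ha p]
  · calc a ^ (p - 1) * b ≤ a ^ (p - 1) * a := by gcongr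
      _ = a ^ p := by rw [← Real.rpow_add_one ha'.ne']; ring_nf
      _ ≤ _ := by linarith [Real.rpow_nonneg hb p]

lemma add_rpow_le_two_rpow_mul {a b p : ℝ} (ha : 0 ≤ a) (hb : 0 ≤ b) (hp : 0 ≤ p) :
    (a + b) ^ p ≤ 2 ^ p * (a ^ p + b ^ p) := by
  have h : ∀ c d : ℝ, 0 ≤ c → 0 ≤ d → c ≤ d → (c + d) ^ p ≤ 2 ^ p * (c ^ p + d ^ p) := by
    intro c d hc hd hcd
    calc (c + d) ^ p ≤ (2 * d) ^ p := by gcongr; linarith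
      _ = 2 ^ p * d ^ p := Real.mul_rpow (by norm_num) hd
      _ ≤ _ := by gcongr; linarith [Real.rpow_nonneg hc p]
  rcases le_total a b with h' | h'
  · exact h a b ha hb h'
  · rw [add_comm a, add_comm (a ^ p)]; exact h b a hb ha h'

lemma rpow_le_rpow_add_ite {v p P : ℝ} (hv : 0 ≤ v) (hp : 0 < p) (hpP : p ≤ P) :
    v ^ p ≤ v ^ P + if 0 < v then 1 else 0 := by
  rcases hv.eq_or_lt with rfl | h
  · simp [Real.zero_rpow hp.ne', Real.zero_rpow (hp.trans_le hpP).ne']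
  · rw [if_pos h]
    rcases le_total v 1 with h1 | h1
    · linarith [Real.rpow_le_one hv h1 hp.le, Real.rpow_nonneg hv P]
    · linarith [Real.rpow_le_rpow_of_exponent_le h1 hpP]

lemma abs_rpow_sub_two_mul_of_pos {d p : ℝ} (hd : 0 < d) :
    |d| ^ (p - 2) * d = d ^ (p - 1) := by
  rw [abs_of_pos hd, ← Real.rpow_add_one hd.ne']; ring_nf

lemma abs_abs_rpow_sub_two_mul {d p : ℝ} (hp : 1 < p) :
    |(|d| ^ (p - 2) * d)| = |d| ^ (p - 1) := by
  rcases eq_or_ne d 0 with rfl | hd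
  · simp [Real.zero_rpow (show p - 1 ≠ 0 by linarith)]
  · rw [abs_mul, abs_of_nonneg (by positivity), ← Real.rpow_add_one (by positivity)]; ring_nf

/-- The excess of `a` above the level `ℓ`. -/
def excess (ℓ a : ℝ) : ℝ := max (a - ℓ) 0

lemma excess_nonneg (ℓ a : ℝ) : 0 ≤ excess ℓ a := le_max_right _ _

lemma abs_excess_sub_le (ℓ a b : ℝ) : |excess ℓ a - excess ℓ b| ≤ |a - b| := by
  have := abs_max_sub_max_le_abs (a - ℓ) (b - ℓ) 0
  simpa [excess] using this

lemma caccioppoli_pointwise_of_le {m : ℕ} {p a b ℓ ζ η : ℝ} (hp : 1 < p) (hm : p ≤ m)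
    (hζ : 0 ≤ ζ) (hη : 0 ≤ η) (hη1 : η ≤ 1) (hba : b ≤ a) :
    |excess ℓ a - excess ℓ b| ^ p * (1 / 2 * min (ζ ^ m) (η ^ m)) ≤
      |a - b| ^ (p - 2) * (a - b) * (excess ℓ a * ζ ^ m - excess ℓ b * η ^ m)
        + (2 * m) ^ p * (excess ℓ a ^ p * |ζ - η| ^ p) := by
  have hva := excess_nonneg ℓ a
  have hvb := excess_nonneg ℓ b
  have hle : excess ℓ b ≤ excess ℓ a := max_le_max (by linarith) le_rfl
  have hd := abs_excess_sub_le ℓ a b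
  have hrest : 0 ≤ (2 * m : ℝ) ^ p * (excess ℓ a ^ p * |ζ - η| ^ p) := by positivity
  rcases hba.eq_or_lt with rfl | hba
  · simp only [sub_self, abs_zero, Real.zero_rpow (show p ≠ 0 by linarith)]
    linarith
  rw [abs_rpow_sub_two_mul_of_pos (sub_pos.2 hba)]
  rw [abs_of_nonneg (sub_nonneg.2 hle)] at hd ⊢
  rw [abs_of_pos (sub_pos.2 hba)] at hd
  set d := excess ℓ a - excess ℓ b with hddef
  have hd0 : 0 ≤ d := sub_nonneg.2 hle
  have hζm : 0 ≤ ζ ^ m := by positivity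
  have hηm : 0 ≤ η ^ m := by positivity
  have hmin0 : 0 ≤ min (ζ ^ m) (η ^ m) := le_min hζm hηm
  have hdp : d ^ p = d ^ (p - 1) * d := by
    rcases hd0.eq_or_lt with h | h
    · rw [← h]; simp [Real.zero_rpow (show p ≠ 0 by linarith)]
    · rw [← Real.rpow_add_one h.ne']; ring_nf
  have hmono : d ^ (p - 1) ≤ (a - b) ^ (p - 1) := by gcongr
  have hsimple : d * min (ζ ^ m) (η ^ m) ≤ excess ℓ a * ζ ^ m - excess ℓ b * η ^ m →
      d ^ p * (1 / 2 * min (ζ ^ m) (η ^ m)) ≤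
      (a - b) ^ (p - 1) * (excess ℓ a * ζ ^ m - excess ℓ b * η ^ m)
        + (2 * m) ^ p * (excess ℓ a ^ p * |ζ - η| ^ p) := by
    intro h
    have h1 : d ^ (p - 1) * (d * min (ζ ^ m) (η ^ m)) ≤
        (a - b) ^ (p - 1) * (excess ℓ a * ζ ^ m - excess ℓ b * η ^ m) := by
      gcongr
    have h2 : 0 ≤ d ^ (p - 1) * (d * min (ζ ^ m) (η ^ m)) := by positivity
    rw [hdp]
    nlinarith
  rcases le_total η ζ with hηζ | hζη
  · apply hsimple
    have h1 : η ^ m ≤ ζ ^ m := by gcongr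
    rw [min_eq_right h1]
    nlinarith
  have h1 : ζ ^ m ≤ η ^ m := by gcongr
  rcases le_or_gt b ℓ with hb | hb
  · apply hsimple
    have : excess ℓ b = 0 := max_eq_right (by linarith)
    rw [min_eq_left h1, hddef, this]; simp
  have heq : a - b = d := by
    rw [hddef, excess, excess, max_eq_left (by linarith), max_eq_left (by linarith)]; ring
  have hdpos : 0 < d := by linarith
  rw [heq, min_eq_left h1]
  set D := |ζ - η| with hD
  have hD0 : 0 ≤ D := abs_nonneg _
  have hm1 : 1 ≤ m := by
    have : (1 : ℝ) < m := by linarith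
    exact_mod_cast this.le
  have hpow : η ^ m - ζ ^ m ≤ D * m * η ^ (m - 1) := by
    have := abs_pow_sub_pow_le η ζ m
    rw [abs_of_nonneg hη, abs_of_nonneg hζ, max_eq_left hζη, abs_sub_comm η ζ] at this
    exact (le_abs_self _).trans this
  have hkey : d ^ (p - 1) * (excess ℓ a * (D * m * η ^ (m - 1))) ≤
      d ^ p * (1 / 2 * η ^ m) + (2 * m) ^ p * (excess ℓ a ^ p * D ^ p) := by
    have hηsplit : η ^ m = η ^ (m - 1) * η := by rw [← pow_succ]; congr 1; omega
    have hη' : 0 ≤ η ^ (m - 1) := by positivity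
    rcases le_or_gt (2 * m * excess ℓ a * D) (d * η) with hc | hc
    · have : d ^ (p - 1) * (excess ℓ a * (D * m * η ^ (m - 1))) ≤ d ^ p * (1 / 2 * η ^ m) := by
        rw [hdp, hηsplit]
        have : 0 ≤ d ^ (p - 1) * η ^ (m - 1) := by positivity
        nlinarith
      linarith
    · have hle1 : η ^ (m - 1) ≤ η ^ (p - 1) := by
        rw [← Real.rpow_natCast]
        rcases hη.eq_or_lt with h | h
        · rw [← h, Real.zero_rpow (x := p - 1) (by linarith), Real.zero_rpow]
          have : (1 : ℝ) < m := by linarith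
          push_cast [hm1]
          linarith
        · exact Real.rpow_le_rpow_of_exponent_ge h hη1 (by push_cast [hm1]; linarith)
      have hXpos : 0 < 2 * m * excess ℓ a * D := lt_of_le_of_lt (by positivity) hc
      have : d ^ (p - 1) * (excess ℓ a * (D * m * η ^ (m - 1))) ≤
          (2 * m) ^ p * (excess ℓ a ^ p * D ^ p) := by
        calc d ^ (p - 1) * (excess ℓ a * (D * m * η ^ (m - 1)))
            ≤ d ^ (p - 1) * (excess ℓ a * (D * m * η ^ (p - 1))) := by gcongr
          _ = (d * η) ^ (p - 1) * (m * excess ℓ a * D) := by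
              rw [Real.mul_rpow hd0 hη]; ring
          _ ≤ (2 * m * excess ℓ a * D) ^ (p - 1) * (2 * m * excess ℓ a * D) := by
              have : (0 : ℝ) ≤ m * excess ℓ a * D := by positivity
              gcongr
              linarith
          _ = (2 * m * excess ℓ a * D) ^ p := by
              rw [← Real.rpow_add_one hXpos.ne']; ring_nf
          _ = _ := by
              rw [Real.mul_rpow (by positivity) hD0, Real.mul_rpow (by positivity) hva]; ring
      have h3 : 0 ≤ d ^ p * (1 / 2 * η ^ m) := by positivity
      linarith
  have hdz : 0 ≤ d ^ (p - 1) := by positivity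
  have e1 : excess ℓ a * ζ ^ m - excess ℓ b * η ^ m =
      d * η ^ m - excess ℓ a * (η ^ m - ζ ^ m) := by rw [hddef]; ring
  have e2 : d ^ (p - 1) * (excess ℓ a * (η ^ m - ζ ^ m)) ≤
      d ^ (p - 1) * (excess ℓ a * (D * m * η ^ (m - 1))) := by gcongr
  have e3 : d ^ p * (1 / 2 * ζ ^ m) ≤ d ^ p * (1 / 2 * η ^ m) := by gcongr
  have e4 : d ^ (p - 1) * (d * η ^ m) = d ^ p * η ^ m := by rw [hdp, mul_assoc]
  rw [e1, mul_sub, e4]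
  linarith

lemma caccioppoli_pointwise {m : ℕ} {p a b ℓ ζ η : ℝ} (hp : 1 < p) (hm : p ≤ m)
    (hζ : 0 ≤ ζ) (hζ1 : ζ ≤ 1) (hη : 0 ≤ η) (hη1 : η ≤ 1) :
    |excess ℓ a - excess ℓ b| ^ p * (1 / 2 * min (ζ ^ m) (η ^ m)) ≤
      |a - b| ^ (p - 2) * (a - b) * (excess ℓ a * ζ ^ m - excess ℓ b * η ^ m)
        + (2 * m) ^ p * ((excess ℓ a ^ p + excess ℓ b ^ p) * |ζ - η| ^ p) := by
  have hva := excess_nonneg ℓ a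
  have hvb := excess_nonneg ℓ b
  rcases le_total b a with h | h
  · refine (caccioppoli_pointwise_of_le hp hm hζ hη hη1 h).trans ?_
    gcongr
    exact le_add_of_nonneg_right (by positivity)
  · have := caccioppoli_pointwise_of_le (ℓ := ℓ) hp hm hη hζ hζ1 h
    rw [abs_sub_comm, min_comm]
    refine this.trans ?_
    rw [abs_sub_comm b a, abs_sub_comm η ζ]
    have : (2 * m : ℝ) ^ p * (excess ℓ b ^ p * |ζ - η| ^ p) ≤
      (2 * m) ^ p * ((excess ℓ a ^ p + excess ℓ b ^ p) * |ζ - η| ^ p) := by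
      gcongr
      exact le_add_of_nonneg_left (by positivity)
    refine le_trans (le_of_eq ?_) (add_le_add_right this _)
    ring

lemma iteration_to_zero {C N δ τ₀ : ℝ} (hC : 0 < C) (hN : 0 < N) (hδ : 0 < δ) (hτ₀ : 0 < τ₀) :
    ∃ ε > 0, ∀ F : ℝ → ℝ, (∀ τ, 0 ≤ F τ) → Antitone F →
      (∀ τ g, 0 ≤ τ → 0 < g → τ + g ≤ τ₀ → F (τ + g) ≤ C * (1 / g) ^ N * F τ ^ (1 + δ)) →
      F 0 ≤ ε → F τ₀ = 0 := by
  set C' : ℝ := C * (2 / τ₀) ^ N with hC'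
  have hC'0 : 0 < C' := by positivity
  set θ : ℝ := (2 : ℝ) ^ (-(N / δ)) with hθ
  have hθ0 : 0 < θ := by positivity
  have hθ1 : θ < 1 := Real.rpow_lt_one_of_one_lt_of_neg (by norm_num) (by
    have : 0 < N / δ := by positivity
    linarith)
  have hθδ : (2 : ℝ) ^ N * θ ^ δ = 1 := by
    rw [hθ, ← Real.rpow_mul (by norm_num), ← Real.rpow_add (by norm_num)]
    have : N + -(N / δ) * δ = 0 := by field_simp; ring
    rw [this, Real.rpow_zero]
  set ε : ℝ := (θ / C') ^ (1 / δ) with hε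
  have hε0 : 0 < ε := by positivity
  have hεδ : C' * ε ^ δ = θ := by
    rw [hε, ← Real.rpow_mul (by positivity), one_div_mul_cancel hδ.ne', Real.rpow_one]
    field_simp
  refine ⟨ε, hε0, fun F hF hanti hstep h0 => ?_⟩
  have hlt : ∀ i : ℕ, (0 : ℝ) < (1 / 2) ^ i := fun i => by positivity
  have hind : ∀ i : ℕ, F (τ₀ * (1 - (1 / 2) ^ i)) ≤ ε * θ ^ i := by
    intro i
    induction i with
    | zero => simpa using h0
    | succ i ih =>
      have hle1 : ((1 : ℝ) / 2) ^ i ≤ 1 := pow_le_one₀ (by norm_num) (by norm_num)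
      have hs := hstep (τ₀ * (1 - (1 / 2) ^ i)) (τ₀ * (1 / 2) ^ (i + 1))
        (mul_nonneg hτ₀.le (by linarith)) (by positivity) (by
          rw [pow_succ]; nlinarith [hlt i])
      have e : τ₀ * (1 - (1 / 2) ^ i) + τ₀ * (1 / 2) ^ (i + 1) = τ₀ * (1 - (1 / 2) ^ (i + 1)) := by
        rw [pow_succ]; ring
      rw [e] at hs
      refine hs.trans ?_
      have e2 : (1 / (τ₀ * (1 / 2) ^ (i + 1))) ^ N = (2 / τ₀) ^ N * ((2 : ℝ) ^ N) ^ i := by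
        rw [← Real.rpow_natCast ((2 : ℝ) ^ N) i, ← Real.rpow_mul (by norm_num), mul_comm N,
          Real.rpow_mul (by norm_num), Real.rpow_natCast,
          ← Real.mul_rpow (by positivity) (by positivity)]
        congr 1
        rw [pow_succ, one_div_pow]; field_simp
      rw [e2]
      calc C * ((2 / τ₀) ^ N * ((2 : ℝ) ^ N) ^ i) * F (τ₀ * (1 - (1 / 2) ^ i)) ^ (1 + δ)
          ≤ C * ((2 / τ₀) ^ N * ((2 : ℝ) ^ N) ^ i) * (ε * θ ^ i) ^ (1 + δ) := by
            gcongr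
            exact hF _
        _ = (C' * ε ^ δ) * ((2 : ℝ) ^ N * θ ^ δ) ^ i * ε * θ ^ i := by
            rw [Real.rpow_add (by positivity), Real.rpow_one, Real.mul_rpow hε0.le (by positivity),
              ← Real.rpow_natCast θ i, ← Real.rpow_mul hθ0.le, mul_comm (i : ℝ) δ,
              Real.rpow_mul hθ0.le, Real.rpow_natCast, Real.rpow_natCast, mul_pow, hC']
            ring
        _ = ε * θ ^ (i + 1) := by rw [hεδ, hθδ]; ring
        _ ≤ _ := le_rfl
  have hlim : Tendsto (fun i : ℕ => ε * θ ^ i) atTop (𝓝 0) := by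
    simpa using (tendsto_pow_atTop_nhds_zero_of_lt_one hθ0.le hθ1).const_mul ε
  refine le_antisymm (ge_of_tendsto' hlim fun i => ?_) (hF _)
  refine (hanti ?_).trans (hind i)
  nlinarith [hlt i]

/-- A radial integrable function on `ℝⁿ` dominating `min(1,‖z‖)^p / ‖z‖^(n + s p)` for `p ≥ 1`. -/
def kernelMajorant {n : ℕ} (s : ℝ) (z : Rn n) : ℝ :=
  if ‖z‖ < 1 then ‖z‖ ^ (1 - s - n) else ‖z‖ ^ (-(n + s))

lemma kernelMajorant_nonneg {n : ℕ} (s : ℝ) (z : Rn n) : 0 ≤ kernelMajorant s z := by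
  unfold kernelMajorant; split_ifs <;> positivity

lemma integrable_kernelMajorant {n : ℕ} (hn : 1 ≤ n) {s : ℝ} (hs : s ∈ Set.Ioo (0 : ℝ) 1) :
    Integrable (kernelMajorant s : Rn n → ℝ) := by
  have : Nontrivial (Rn n) := by
    have : Nonempty (Fin n) := ⟨⟨0, hn⟩⟩
    infer_instance
  have h := (integrable_fun_norm_addHaar (volume : Measure (Rn n))
    (f := fun r : ℝ => if r < 1 then r ^ (1 - s - n) else r ^ (-(n + s)))).2 ?_
  · exact h
  rw [finrank_euclideanSpace_fin, ← Ioo_union_Ici_eq_Ioi (zero_lt_one' ℝ)]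
  have hcast : ((n - 1 : ℕ) : ℝ) = n - 1 := by push_cast [hn]; ring
  refine IntegrableOn.union ?_ ?_
  · refine ((intervalIntegral.integrableOn_Ioo_rpow_iff (s := -s) zero_lt_one).2
      (by linarith [hs.2])).congr_fun (fun r hr => ?_) measurableSet_Ioo
    simp only [smul_eq_mul, if_pos hr.2]
    rw [← Real.rpow_natCast, ← Real.rpow_add hr.1, hcast]
    ring_nf
  · rw [integrableOn_Ici_iff_integrableOn_Ioi]
    refine (integrableOn_Ioi_rpow_of_lt (a := -1 - s) (by linarith [hs.1])
      zero_lt_one).congr_fun (fun r hr => ?_) measurableSet_Ioi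
    have hr' : (1 : ℝ) < r := hr
    simp only [smul_eq_mul, if_neg (not_lt.2 hr'.le)]
    rw [← Real.rpow_natCast, ← Real.rpow_add (by linarith), hcast]
    ring_nf

lemma div_kernel_le_kernelMajorant {n : ℕ} {s q L D Q : ℝ} (hs : s ∈ Set.Ioo (0 : ℝ) 1)
    (hq : 1 ≤ q) (hqQ : q ≤ Q) (hL : 1 ≤ L) (x y : Rn n) (hD : 0 ≤ D) (hD1 : D ≤ 1)
    (hDL : D ≤ L * ‖x - y‖) :
    D ^ q / ‖x - y‖ ^ ((n : ℝ) + s * q) ≤ L ^ Q * kernelMajorant s (x - y) := by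
  set r := ‖x - y‖ with hr
  have hr0 : 0 ≤ r := norm_nonneg _
  have hLQ : L ^ q ≤ L ^ Q := Real.rpow_le_rpow_of_exponent_le hL hqQ
  have hLQ1 : 1 ≤ L ^ Q := Real.one_le_rpow hL (by linarith)
  rcases hr0.eq_or_lt with h | h
  · have : D = 0 := by rw [← h] at hDL; linarith
    rw [this, Real.zero_rpow (by linarith), zero_div]
    have := kernelMajorant_nonneg s (x - y)
    positivity
  unfold kernelMajorant
  rw [← hr]
  split_ifs with h1
  · calc D ^ q / r ^ ((n : ℝ) + s * q) ≤ (L * r) ^ q / r ^ ((n : ℝ) + s * q) := by gcongr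
      _ = L ^ q * r ^ (q * (1 - s) - n) := by
        rw [Real.mul_rpow (by linarith) hr0, mul_div_assoc, ← Real.rpow_sub h]
        ring_nf
      _ ≤ L ^ Q * r ^ (1 - s - n) := by
        gcongr 1
        exact Real.rpow_le_rpow_of_exponent_ge h h1.le (by nlinarith [hs.2])
  · calc D ^ q / r ^ ((n : ℝ) + s * q) ≤ 1 / r ^ ((n : ℝ) + s * q) := by
          gcongr; exact Real.rpow_le_one hD hD1 (by linarith)
      _ ≤ 1 / r ^ ((n : ℝ) + s) := by
          gcongr
          · exact not_lt.1 h1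
          · nlinarith [hs.1]
      _ = 1 * r ^ (-((n : ℝ) + s)) := by rw [Real.rpow_neg hr0]; ring
      _ ≤ _ := by gcongr

/-- The integrand of the fractional energy with exponent `p`. -/
def energyDensity {n : ℕ} (s : ℝ) (p : Rn n → Rn n → ℝ) (v : Rn n → ℝ) (x y : Rn n) : ℝ :=
  |v x - v y| ^ p x y / ‖x - y‖ ^ ((n : ℝ) + s * p x y)

lemma energyDensity_nonneg {n : ℕ} (s : ℝ) (p : Rn n → Rn n → ℝ) (v : Rn n → ℝ) (x y : Rn n) :
    0 ≤ energyDensity s p v x y := by unfold energyDensity; positivity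

/-- The volume of the unit ball of `ℝⁿ`. -/
def unitBallVolume (n : ℕ) : ℝ := (volume (ball (0 : Rn n) 1)).toReal

lemma unitBallVolume_pos (n : ℕ) : 0 < unitBallVolume n :=
  ENNReal.toReal_pos (measure_ball_pos _ _ one_pos).ne' measure_ball_lt_top.ne

lemma volume_ball_eq_unitBallVolume {n : ℕ} (hn : 1 ≤ n) (x : Rn n) {r : ℝ} (hr : 0 ≤ r) :
    volume (ball x r) = ENNReal.ofReal (unitBallVolume n * r ^ n) := by
  have : Nontrivial (Rn n) := by
    have : Nonempty (Fin n) := ⟨⟨0, hn⟩⟩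
    infer_instance
  rw [Measure.addHaar_ball _ _ hr, finrank_euclideanSpace_fin, mul_comm (unitBallVolume n),
    ENNReal.ofReal_mul (by positivity), unitBallVolume, ENNReal.ofReal_toReal
    measure_ball_lt_top.ne]

lemma ofReal_le_setLIntegral_energyDensity {n : ℕ} (hn : 1 ≤ n) {s q P ρ r₀ a : ℝ} (hs : 0 < s)
    (hq : 0 < q) {p : Rn n → Rn n → ℝ} {v : Rn n → ℝ} (hv : Measurable v) {x₀ x : Rn n}
    (hx : x ∈ ball x₀ ρ) (hvx : 0 < v x)
    (hp : ∀ y ∈ ball x₀ ρ, q ≤ p x y ∧ p x y ≤ P)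
    (hball : ball x r₀ ⊆ ball x₀ ρ) (hr₀ : 0 ≤ r₀) (hr₁ : r₀ ≤ 1) (ha : 0 < a)
    (har : 2 * a ≤ unitBallVolume n * r₀ ^ n)
    (hvol : volume {y ∈ ball x₀ ρ | v x / 2 < v y} ≤ ENNReal.ofReal a) :
    ENNReal.ofReal (2 ^ (-P) * (unitBallVolume n / 2) ^ (1 + s * q / n)
        * min (v x ^ q) (v x ^ P) * a ^ (-(s * q / n)))
      ≤ ∫⁻ y in ball x₀ ρ, ENNReal.ofReal (energyDensity s p v x y) := by
  set ω := unitBallVolume n with hω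
  have hω0 : 0 < ω := unitBallVolume_pos n
  have hn0 : (0 : ℝ) < n := by exact_mod_cast hn
  have hqP : q ≤ P := (hp x hx).1.trans (hp x hx).2
  set r : ℝ := (2 * a / ω) ^ (1 / (n : ℝ)) with hr
  have hrpos : 0 < r := by positivity
  have hrn : r ^ n = 2 * a / ω := by
    rw [← Real.rpow_natCast, hr, ← Real.rpow_mul (by positivity), one_div_mul_cancel hn0.ne',
      Real.rpow_one]
  have hrr : r ≤ r₀ := by
    refine le_of_pow_le_pow_left₀ (n := n) (by omega) hr₀ ?_
    rw [hrn, div_le_iff₀ hω0]; linarith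
  set G := ball x r \ {y ∈ ball x₀ ρ | v x / 2 < v y} with hG
  have hGmeas : MeasurableSet G :=
    measurableSet_ball.diff (measurableSet_ball.inter (measurableSet_lt measurable_const hv))
  have hGsub : G ⊆ ball x₀ ρ := fun y hy => hball (ball_subset_ball hrr hy.1)
  have hGvol : ENNReal.ofReal a ≤ volume G := by
    have h1 : volume (ball x r) = ENNReal.ofReal (2 * a) := by
      rw [volume_ball_eq_unitBallVolume hn x hrpos.le, hrn]
      congr 1; rw [← hω]; field_simp
    have h2 : volume (ball x r) - volume {y ∈ ball x₀ ρ | v x / 2 < v y} ≤ volume G :=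
      le_measure_sdiff
    refine le_trans ?_ h2
    rw [h1]
    calc ENNReal.ofReal a = ENNReal.ofReal (2 * a) - ENNReal.ofReal a := by
          rw [← ENNReal.ofReal_sub _ ha.le]; congr 1; ring
      _ ≤ _ := tsub_le_tsub_left hvol _
  set c : ℝ := 2 ^ (-P) * min (v x ^ q) (v x ^ P) / r ^ ((n : ℝ) + s * q) with hc
  have hmin0 : 0 ≤ min (v x ^ q) (v x ^ P) := le_min (by positivity) (by positivity)
  have hc0 : 0 ≤ c := by positivity
  have hdens : ∀ y ∈ G, c ≤ energyDensity s p v x y := by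
    intro y hy
    obtain ⟨hpq, hpP⟩ := hp y (hGsub hy)
    have hvy : v y ≤ v x / 2 := by
      by_contra! h
      exact hy.2 ⟨hGsub hy, h⟩
    have hd : ‖x - y‖ < r := by
      have := hy.1
      rwa [mem_ball, dist_comm, dist_eq_norm] at this
    have hne : x ≠ y := by
      rintro rfl; linarith
    have hd0 : 0 < ‖x - y‖ := norm_pos_iff.2 (sub_ne_zero.2 hne)
    have h1 : v x / 2 ≤ |v x - v y| := by
      rw [abs_of_nonneg (by linarith)]; linarith
    have h2 : min (v x ^ q) (v x ^ P) ≤ v x ^ p x y := by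
      rcases le_total (v x) 1 with h | h
      · exact (min_le_right _ _).trans (Real.rpow_le_rpow_of_exponent_ge hvx h hpP)
      · exact (min_le_left _ _).trans (Real.rpow_le_rpow_of_exponent_le h hpq)
    unfold energyDensity
    rw [hc]
    gcongr
    · calc (2 : ℝ) ^ (-P) * min (v x ^ q) (v x ^ P) ≤ 2 ^ (-p x y) * v x ^ p x y := by
            gcongr; norm_num
        _ = (v x / 2) ^ p x y := by
            rw [Real.div_rpow hvx.le (by norm_num), Real.rpow_neg (by norm_num)]; ring
        _ ≤ _ := Real.rpow_le_rpow (by positivity) h1 (by linarith)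
    · calc ‖x - y‖ ^ ((n : ℝ) + s * p x y) ≤ ‖x - y‖ ^ ((n : ℝ) + s * q) := by
            refine Real.rpow_le_rpow_of_exponent_ge hd0 (by linarith) ?_
            gcongr
        _ ≤ r ^ ((n : ℝ) + s * q) := by gcongr
  have hrexp : r ^ ((n : ℝ) + s * q) = (2 * a / ω) ^ (1 + s * q / n) := by
    rw [hr, ← Real.rpow_mul (by positivity)]
    congr 1; field_simp
  calc ENNReal.ofReal (2 ^ (-P) * (ω / 2) ^ (1 + s * q / n)
        * min (v x ^ q) (v x ^ P) * a ^ (-(s * q / n))) = ENNReal.ofReal c * ENNReal.ofReal a := by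
        rw [← ENNReal.ofReal_mul hc0]
        congr 1
        rw [hc, hrexp]
        have e : (2 * a / ω) = a / (ω / 2) := by field_simp
        rw [e, Real.div_rpow ha.le (by positivity), Real.rpow_add ha, Real.rpow_one,
          Real.rpow_neg ha.le]
        have : a ^ (s * q / n) ≠ 0 := by positivity
        field_simp
    _ ≤ ENNReal.ofReal c * volume G := by gcongr
    _ = ∫⁻ _ in G, ENNReal.ofReal c := (setLIntegral_const _ _).symm
    _ ≤ ∫⁻ y in G, ENNReal.ofReal (energyDensity s p v x y) :=
        setLIntegral_mono' hGmeas fun y hy => ENNReal.ofReal_le_ofReal (hdens y hy)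
    _ ≤ _ := lintegral_mono_set hGsub

/-- Gain of integrability from a finite fractional energy: weak-type control of the level sets
of `v` improves the power that can be integrated. -/
lemma setLIntegral_rpow_le_energy {n : ℕ} (hn : 1 ≤ n) {s q P t : ℝ} (hs : 0 < s) (hq : 0 < q)
    (ht : 0 < t) (hPt : P ≤ q + t * (s * q / n)) :
    ∃ C > 0, ∀ (p : Rn n → Rn n → ℝ) (v : Rn n → ℝ) (x₀ : Rn n) (ρ' ρ r₀ S : ℝ), Measurable v →
      (∀ x, 0 ≤ v x) → 0 < P →
      (∀ x ∈ ball x₀ ρ, ∀ y ∈ ball x₀ ρ, q ≤ p x y ∧ p x y ≤ P) →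
      0 ≤ r₀ → r₀ ≤ 1 → ρ' + r₀ ≤ ρ → 0 < S → 2 * (2 ^ t * S) ≤ unitBallVolume n * r₀ ^ n →
      volume {y ∈ ball x₀ ρ | 0 < v y} ≤ ENNReal.ofReal S →
      (∀ l > 0, volume {y ∈ ball x₀ ρ | l < v y} ≤ ENNReal.ofReal (S * l ^ (-t))) →
      ∫⁻ x in ball x₀ ρ', ENNReal.ofReal (v x ^ P) ≤
        ENNReal.ofReal (C * S ^ (s * q / n)) *
          ∫⁻ x in ball x₀ ρ, ∫⁻ y in ball x₀ ρ, ENNReal.ofReal (energyDensity s p v x y) := by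
  set δ := s * q / n with hδ
  have hn0 : (0 : ℝ) < n := by exact_mod_cast hn
  have hδ0 : 0 < δ := by positivity
  set ω := unitBallVolume n with hω
  have hω0 : 0 < ω := unitBallVolume_pos n
  set c : ℝ := 2 ^ (-P) * (ω / 2) ^ (1 + δ) * 2 ^ (-(t * δ)) with hc
  have hc0 : 0 < c := by positivity
  refine ⟨1 / c, by positivity, ?_⟩
  intro p v x₀ ρ' ρ r₀ S hvm hv0 hP hp hr₀ hr₁ hρ hS hSr h0 hl
  have h2t : (1 : ℝ) ≤ 2 ^ t := Real.one_le_rpow (by norm_num) ht.le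
  have hsub : ball x₀ ρ' ⊆ ball x₀ ρ := ball_subset_ball (by linarith)
  have hpt : ∀ x ∈ ball x₀ ρ', ENNReal.ofReal (v x ^ P) ≤ ENNReal.ofReal (1 / c * S ^ δ) *
      ∫⁻ y in ball x₀ ρ, ENNReal.ofReal (energyDensity s p v x y) := by
    intro x hx
    rcases (hv0 x).eq_or_lt with hvx | hvx
    · rw [← hvx, Real.zero_rpow hP.ne']; simp
    have hball : ball x r₀ ⊆ ball x₀ ρ := by
      refine ball_subset_ball' ?_
      have := mem_ball.1 hx
      linarith
    have hqP : q ≤ P := (hp x (hsub hx) x (hsub hx)).1.trans (hp x (hsub hx) x (hsub hx)).2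
    suffices h : ENNReal.ofReal (c * S ^ (-δ) * v x ^ P) ≤
        ∫⁻ y in ball x₀ ρ, ENNReal.ofReal (energyDensity s p v x y) by
      calc ENNReal.ofReal (v x ^ P)
          = ENNReal.ofReal (1 / c * S ^ δ) * ENNReal.ofReal (c * S ^ (-δ) * v x ^ P) := by
            rw [← ENNReal.ofReal_mul (by positivity)]
            congr 1
            rw [Real.rpow_neg hS.le]
            have : S ^ δ ≠ 0 := by positivity
            field_simp
        _ ≤ _ := by gcongr
    rcases le_or_gt (v x) 1 with h1 | h1
    · refine le_trans (ENNReal.ofReal_le_ofReal ?_)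
        (ofReal_le_setLIntegral_energyDensity hn hs hq hvm (hsub hx) hvx (hp x (hsub hx)) hball
          hr₀ hr₁ hS (by nlinarith) (le_trans (measure_mono ?_) h0))
      · rw [min_eq_right (Real.rpow_le_rpow_of_exponent_ge hvx h1 hqP)]
        have : (2 : ℝ) ^ (-(t * δ)) ≤ 1 :=
          Real.rpow_le_one_of_one_le_of_nonpos (by norm_num) (by
            have : 0 < t * δ := by positivity
            linarith)
        calc c * S ^ (-δ) * v x ^ P ≤ 2 ^ (-P) * (ω / 2) ^ (1 + δ) * 1 * S ^ (-δ) * v x ^ P := by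
              rw [hc]; gcongr
          _ = _ := by ring
      · exact fun y hy => ⟨hy.1, lt_of_le_of_lt (by positivity) hy.2⟩
    · have hvt : v x ^ (-t) ≤ 1 := Real.rpow_le_one_of_one_le_of_nonpos h1.le (by linarith)
      have ha : 2 * (2 ^ t * S * v x ^ (-t)) ≤ ω * r₀ ^ n := by
        refine le_trans ?_ hSr
        have : 2 ^ t * S * v x ^ (-t) ≤ 2 ^ t * S * 1 := by gcongr
        linarith
      refine le_trans (ENNReal.ofReal_le_ofReal ?_)
        (ofReal_le_setLIntegral_energyDensity (a := 2 ^ t * S * v x ^ (-t)) hn hs hq hvm (hsub hx)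
          hvx (hp x (hsub hx)) hball hr₀ hr₁ (by positivity) ha
          (le_trans (hl (v x / 2) (by positivity)) (ENNReal.ofReal_le_ofReal (le_of_eq ?_))))
      · rw [min_eq_left (Real.rpow_le_rpow_of_exponent_le h1.le hqP)]
        have e : (2 ^ t * S * v x ^ (-t)) ^ (-δ) = 2 ^ (-(t * δ)) * S ^ (-δ) * v x ^ (t * δ) := by
          rw [Real.mul_rpow (by positivity) (by positivity),
            Real.mul_rpow (by positivity) (by positivity), ← Real.rpow_mul (by norm_num),
            ← Real.rpow_mul hvx.le]
          congr 2
          · congr 2; ring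
          · ring
        calc c * S ^ (-δ) * v x ^ P ≤ c * S ^ (-δ) * v x ^ (q + t * δ) := by
              gcongr
              exact h1.le
          _ = _ := by rw [e, Real.rpow_add hvx, hc]; ring
      · rw [Real.div_rpow hvx.le (by norm_num), Real.rpow_neg (by norm_num : (0:ℝ) ≤ 2)]
        field_simp
  calc ∫⁻ x in ball x₀ ρ', ENNReal.ofReal (v x ^ P)
      ≤ ∫⁻ x in ball x₀ ρ', ENNReal.ofReal (1 / c * S ^ δ) *
          ∫⁻ y in ball x₀ ρ, ENNReal.ofReal (energyDensity s p v x y) :=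
        setLIntegral_mono' measurableSet_ball hpt
    _ ≤ ∫⁻ x in ball x₀ ρ, ENNReal.ofReal (1 / c * S ^ δ) *
          ∫⁻ y in ball x₀ ρ, ENNReal.ofReal (energyDensity s p v x y) := lintegral_mono_set hsub
    _ = _ := lintegral_const_mul' _ _ ENNReal.ofReal_ne_top

lemma measurable_energyDensity {n : ℕ} {s : ℝ} {p : Rn n → Rn n → ℝ} {v : Rn n → ℝ}
    (hp : Measurable fun z : Rn n × Rn n => p z.1 z.2) (hv : Measurable v) :
    Measurable fun z : Rn n × Rn n => energyDensity s p v z.1 z.2 := by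
  unfold energyDensity
  fun_prop

lemma integrable_energyDensity {n : ℕ} {s : ℝ} {p : Rn n → Rn n → ℝ} {v : Rn n → ℝ}
    (hp : Measurable fun z : Rn n × Rn n => p z.1 z.2) (hv : MemW s p v) :
    Integrable fun z : Rn n × Rn n => energyDensity s p v z.1 z.2 := by
  have hm := measurable_energyDensity (s := s) hp hv.1
  refine ⟨hm.aestronglyMeasurable, ?_⟩
  rw [hasFiniteIntegral_iff_ofReal (Eventually.of_forall fun z => energyDensity_nonneg _ _ _ _ _),
    Measure.volume_eq_prod, lintegral_prod _ hm.ennreal_ofReal.aemeasurable]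
  exact hv.2.2

/-- The integrand of the weak formulation of the equation for `w`, tested with `φ`. -/
def weakIntegrand {n : ℕ} (s : ℝ) (p : Rn n → Rn n → ℝ) (w φ : Rn n → ℝ) (z : Rn n × Rn n) : ℝ :=
  |w z.1 - w z.2| ^ (p z.1 z.2 - 2) * (w z.1 - w z.2) * (φ z.1 - φ z.2)
    / ‖z.1 - z.2‖ ^ ((n : ℝ) + s * p z.1 z.2)

lemma measurable_weakIntegrand {n : ℕ} {s : ℝ} {p : Rn n → Rn n → ℝ} {w φ : Rn n → ℝ}
    (hp : Measurable fun z : Rn n × Rn n => p z.1 z.2) (hw : Measurable w) (hφ : Measurable φ) :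
    Measurable (weakIntegrand s p w φ) := by
  unfold weakIntegrand
  fun_prop

lemma abs_weakIntegrand {n : ℕ} {s : ℝ} {p : Rn n → Rn n → ℝ} (w φ : Rn n → ℝ)
    (hp : ∀ x y, 1 < p x y) (z : Rn n × Rn n) :
    |weakIntegrand s p w φ z| = |w z.1 - w z.2| ^ (p z.1 z.2 - 1) * |φ z.1 - φ z.2|
      / ‖z.1 - z.2‖ ^ ((n : ℝ) + s * p z.1 z.2) := by
  rw [weakIntegrand, abs_div, abs_mul, abs_abs_rpow_sub_two_mul (hp _ _),
    abs_of_nonneg (a := ‖z.1 - z.2‖ ^ _) (by positivity)]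

lemma integrable_weakIntegrand {n : ℕ} {s : ℝ} {p : Rn n → Rn n → ℝ} {w φ : Rn n → ℝ}
    (hpm : Measurable fun z : Rn n × Rn n => p z.1 z.2) (hp : ∀ x y, 1 < p x y)
    (hw : MemW s p w) (hφ : MemW s p φ) : Integrable (weakIntegrand s p w φ) := by
  refine ((integrable_energyDensity hpm hw).add (integrable_energyDensity hpm hφ)).mono'
    (measurable_weakIntegrand hpm hw.1 hφ.1).aestronglyMeasurable
    (Eventually.of_forall fun z => ?_)
  rw [Real.norm_eq_abs, abs_weakIntegrand w φ hp]
  simp only [Pi.add_apply, energyDensity]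
  rw [← add_div]
  gcongr
  exact rpow_sub_one_mul_le (abs_nonneg _) (abs_nonneg _) (hp _ _)

lemma MemW.neg {n : ℕ} {s : ℝ} {p : Rn n → Rn n → ℝ} {u : Rn n → ℝ} (hu : MemW s p u) :
    MemW s p (fun x => -u x) := by
  refine ⟨hu.1.neg, ?_, ?_⟩
  · simpa only [abs_neg] using hu.2.1
  · have h : ∀ x y, |-u x - -u y| = |u x - u y| := fun x y => by
      rw [← abs_neg]; congr 1; ring
    simpa only [h] using hu.2.2

lemma IsWeakSupersol.integral_weakIntegrand_neg_nonpos {n : ℕ} {s : ℝ} {p : Rn n → Rn n → ℝ}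
    {Ω : Set (Rn n)} {u φ : Rn n → ℝ} (hpm : Measurable fun z : Rn n × Rn n => p z.1 z.2)
    (hp : ∀ x y, 1 < p x y) (hu : MemW s p u) (hsup : IsWeakSupersol s p Ω u) (hφ : MemW s p φ)
    (hφ0 : ∀ x, 0 ≤ φ x) (hφΩ : ∀ x, x ∉ Ω → φ x = 0) :
    ∫ z, weakIntegrand s p (fun x => -u x) φ z ≤ 0 := by
  have h := hsup φ hφ hφ0 (Eventually.of_forall hφΩ)
  have hint := integrable_weakIntegrand hpm hp hu hφ
  have e := integral_prod _ (Measure.volume_eq_prod (Rn n) (Rn n) ▸ hint)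
  rw [← Measure.volume_eq_prod] at e
  have h' : 0 ≤ ∫ z, weakIntegrand s p u φ z := by rw [e]; exact h
  have hneg : weakIntegrand s p (fun x => -u x) φ = fun z => -weakIntegrand s p u φ z := by
    funext z
    have h1 : |-u z.1 - -u z.2| = |u z.1 - u z.2| := by rw [← abs_neg]; congr 1; ring
    simp only [weakIntegrand, h1]
    ring
  rw [hneg, integral_neg]
  linarith

lemma kernelMajorant_neg {n : ℕ} (s : ℝ) (z : Rn n) :
    kernelMajorant s (-z) = kernelMajorant s z := by
  simp [kernelMajorant]

lemma integrable_mul_kernelMajorant {n : ℕ} (hn : 1 ≤ n) {s : ℝ} (hs : s ∈ Set.Ioo (0 : ℝ) 1)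
    {f : Rn n → ℝ} (hf : Integrable f) :
    Integrable (fun z : Rn n × Rn n => f z.1 * kernelMajorant s (z.1 - z.2)) ∧
      ∫ z : Rn n × Rn n, f z.1 * kernelMajorant s (z.1 - z.2) =
        (∫ x, f x) * ∫ x : Rn n, kernelMajorant s x := by
  have hg := integrable_kernelMajorant hn hs
  have h1 := (hf.convolution_integrand (ContinuousLinearMap.mul ℝ ℝ) hg).swap
  have h2 : Integrable (fun z : Rn n × Rn n => f z.1 * kernelMajorant s (z.1 - z.2))
      (volume.prod volume) := by
    refine h1.congr (Eventually.of_forall fun z => ?_)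
    simp [← kernelMajorant_neg s (z.2 - z.1)]
  refine ⟨h2, ?_⟩
  rw [Measure.volume_eq_prod, integral_prod _ h2, ← integral_mul_const]
  congr 1
  funext x
  simp only
  rw [integral_const_mul, integral_sub_left_eq_self (fun y => kernelMajorant s y)]

lemma integrable_mul_kernelMajorant_snd {n : ℕ} (hn : 1 ≤ n) {s : ℝ}
    (hs : s ∈ Set.Ioo (0 : ℝ) 1) {f : Rn n → ℝ} (hf : Integrable f) :
    Integrable (fun z : Rn n × Rn n => f z.2 * kernelMajorant s (z.1 - z.2)) ∧
      ∫ z : Rn n × Rn n, f z.2 * kernelMajorant s (z.1 - z.2) =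
        (∫ x, f x) * ∫ x : Rn n, kernelMajorant s x := by
  obtain ⟨h1, h2⟩ := integrable_mul_kernelMajorant hn hs hf
  have e : (fun z : Rn n × Rn n => f z.2 * kernelMajorant s (z.1 - z.2)) =
      fun z => (fun z : Rn n × Rn n => f z.1 * kernelMajorant s (z.1 - z.2)) z.swap := by
    funext z
    simp [← kernelMajorant_neg s (z.1 - z.2)]
  rw [e]
  rw [Measure.volume_eq_prod] at h1 h2 ⊢
  exact ⟨h1.swap, (integral_prod_swap _).trans h2⟩

lemma abs_min_mul_sub_min_mul_le {a b T ζ η : ℝ} (hb : 0 ≤ b) (hT : 0 ≤ T)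
    (hζ : 0 ≤ ζ) (hζ1 : ζ ≤ 1) :
    |min a T * ζ - min b T * η| ≤ |a - b| + min b T * |ζ - η| := by
  have h1 : |min a T - min b T| ≤ |a - b| := by
    simpa using abs_min_sub_min_le_max a T b T
  have h2 : 0 ≤ min b T := le_min hb hT
  calc |min a T * ζ - min b T * η| = |(min a T - min b T) * ζ + min b T * (ζ - η)| := by
        congr 1; ring
    _ ≤ |(min a T - min b T) * ζ| + |min b T * (ζ - η)| := abs_add_le _ _
    _ = |min a T - min b T| * ζ + min b T * |ζ - η| := by
        rw [abs_mul, abs_mul, abs_of_nonneg hζ, abs_of_nonneg h2]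
    _ ≤ |a - b| * 1 + min b T * |ζ - η| := by gcongr
    _ = _ := by rw [mul_one]

lemma abs_pow_sub_pow_le_natCast_mul {ζ η : ℝ} (m : ℕ) (hζ : 0 ≤ ζ) (hζ1 : ζ ≤ 1) (hη : 0 ≤ η)
    (hη1 : η ≤ 1) : |ζ ^ m - η ^ m| ≤ m * |ζ - η| := by
  refine (abs_pow_sub_pow_le ζ η m).trans ?_
  have : max |ζ| |η| ^ (m - 1) ≤ 1 := by
    refine pow_le_one₀ (by positivity) ?_
    rw [abs_of_nonneg hζ, abs_of_nonneg hη]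
    exact max_le hζ1 hη1
  calc |ζ - η| * m * max |ζ| |η| ^ (m - 1) ≤ |ζ - η| * m * 1 := by gcongr
    _ = _ := by ring

/-- The cutoff functions used in the Caccioppoli estimate: Lipschitz with values in `[0,1]`,
vanishing outside `B`. -/
structure IsCutoff {n : ℕ} (η : Rn n → ℝ) (B : Set (Rn n)) (L : ℝ) : Prop where
  measurable : Measurable η
  nonneg : ∀ x, 0 ≤ η x
  le_one : ∀ x, η x ≤ 1
  one_le : 1 ≤ L
  lipschitz : ∀ x y, |η x - η y| ≤ L * ‖x - y‖
  eq_zero : ∀ x, x ∉ B → η x = 0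

lemma IsCutoff.div_kernel_le {n : ℕ} {η : Rn n → ℝ} {B : Set (Rn n)} {L s q : ℝ} {m : ℕ}
    (h : IsCutoff η B L) (hs : s ∈ Set.Ioo (0 : ℝ) 1) (hq : 1 ≤ q) (hqm : q ≤ m) (x y : Rn n) :
    |η x - η y| ^ q / ‖x - y‖ ^ ((n : ℝ) + s * q) ≤ L ^ (m : ℝ) * kernelMajorant s (x - y) :=
  div_kernel_le_kernelMajorant hs hq hqm h.one_le x y (abs_nonneg _)
    (abs_sub_le_iff.2 ⟨by linarith [h.nonneg y, h.le_one x], by linarith [h.nonneg x, h.le_one y]⟩)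
    (h.lipschitz x y)

lemma IsCutoff.pow {n : ℕ} {η : Rn n → ℝ} {B : Set (Rn n)} {L : ℝ} (h : IsCutoff η B L) {m : ℕ}
    (hm : 1 ≤ m) : IsCutoff (fun x => η x ^ m) B (m * L) where
  measurable := h.measurable.pow_const m
  nonneg x := pow_nonneg (h.nonneg x) m
  le_one x := pow_le_one₀ (h.nonneg x) (h.le_one x)
  one_le := by
    have : (1 : ℝ) ≤ m := by exact_mod_cast hm
    nlinarith [h.one_le]
  lipschitz x y := by
    refine (abs_pow_sub_pow_le_natCast_mul m (h.nonneg x) (h.le_one x) (h.nonneg y)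
      (h.le_one y)).trans ?_
    rw [mul_assoc]
    gcongr
    exact h.lipschitz x y
  eq_zero x hx := by rw [h.eq_zero x hx, zero_pow (by omega)]

lemma memW_min_excess_mul {n : ℕ} (hn : 1 ≤ n) {s : ℝ} (hs : s ∈ Set.Ioo (0 : ℝ) 1)
    {p : Rn n → Rn n → ℝ} (hpm : Measurable fun z : Rn n × Rn n => p z.1 z.2)
    {m : ℕ} (hp : ∀ x y, 1 < p x y ∧ p x y ≤ m) {w ζ : Rn n → ℝ} (hw : MemW s p w)
    {x₀ : Rn n} {ρ L : ℝ} (hζ : IsCutoff ζ (ball x₀ ρ) L) (ℓ : ℝ) {T : ℝ} (hT : 0 ≤ T) :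
    MemW s p (fun x => min (excess ℓ (w x)) T * ζ x) := by
  set φ : Rn n → ℝ := fun x => min (excess ℓ (w x)) T * ζ x with hφ
  have hφm : Measurable φ :=
    (((hw.1.sub_const ℓ).max measurable_const).min measurable_const).mul hζ.measurable
  have hφ0 : ∀ x, 0 ≤ φ x := fun x => mul_nonneg (le_min (excess_nonneg _ _) hT) (hζ.nonneg x)
  have hφT : ∀ x, φ x ≤ 1 + T := fun x => by
    have h1 : φ x ≤ T * 1 := mul_le_mul (min_le_right _ _) (hζ.le_one x) (hζ.nonneg x) hT
    linarith
  set χ : Rn n → ℝ := (ball x₀ ρ).indicator fun _ => 1 with hχ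
  have hχ0 : ∀ x, 0 ≤ χ x := fun x => indicator_nonneg (fun _ _ => zero_le_one) x
  have hχint : Integrable χ :=
    (integrable_indicator_iff measurableSet_ball).2 (integrableOn_const measure_ball_lt_top.ne)
  refine ⟨hφm, ?_, ?_⟩
  · have hle : ∀ x, ENNReal.ofReal (|φ x| ^ p x x) ≤
        (ball x₀ ρ).indicator (fun _ => ENNReal.ofReal ((1 + T) ^ (m : ℝ))) x := by
      intro x
      by_cases hx : x ∈ ball x₀ ρ
      · rw [indicator_of_mem hx]
        refine ENNReal.ofReal_le_ofReal ?_
        rw [abs_of_nonneg (hφ0 x)]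
        calc φ x ^ p x x ≤ (1 + T) ^ p x x :=
              Real.rpow_le_rpow (hφ0 x) (hφT x) (by linarith [(hp x x).1])
          _ ≤ _ := Real.rpow_le_rpow_of_exponent_le (by linarith) (hp x x).2
      · have : φ x = 0 := by simp [hφ, hζ.eq_zero x hx]
        rw [this, abs_zero, Real.zero_rpow (by linarith [(hp x x).1])]
        simp
    refine (lintegral_mono hle).trans_lt ?_
    rw [lintegral_indicator measurableSet_ball, setLIntegral_const]
    exact ENNReal.mul_lt_top ENNReal.ofReal_lt_top measure_ball_lt_top
  · have hbound : Integrable fun z : Rn n × Rn n => 2 ^ (m : ℝ) * (energyDensity s p w z.1 z.2 +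
        (1 + T) ^ (m : ℝ) * L ^ (m : ℝ) * (χ z.1 * kernelMajorant s (z.1 - z.2)
          + χ z.2 * kernelMajorant s (z.1 - z.2))) :=
      ((integrable_energyDensity hpm hw).add
        (((integrable_mul_kernelMajorant hn hs hχint).1.add
          (integrable_mul_kernelMajorant_snd hn hs hχint).1).const_mul _)).const_mul _
    have hint : Integrable fun z : Rn n × Rn n => energyDensity s p φ z.1 z.2 := by
      refine hbound.mono' (measurable_energyDensity hpm hφm).aestronglyMeasurable
        (Eventually.of_forall fun z => ?_)
      obtain ⟨x, y⟩ := z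
      rw [Real.norm_of_nonneg (energyDensity_nonneg _ _ _ _ _)]
      obtain ⟨hp1, hpm'⟩ := hp x y
      have hT1 : 1 ≤ 1 + T := by linarith
      have hG := kernelMajorant_nonneg s (x - y)
      have hterm : ((1 + T) * |ζ x - ζ y|) ^ p x y / ‖x - y‖ ^ ((n : ℝ) + s * p x y) ≤
          (1 + T) ^ (m : ℝ) * L ^ (m : ℝ) * (χ x * kernelMajorant s (x - y)
            + χ y * kernelMajorant s (x - y)) := by
        by_cases hxy : x ∈ ball x₀ ρ ∨ y ∈ ball x₀ ρ
        · have h1 : 1 ≤ χ x + χ y := by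
            rcases hxy with h | h
            · have : χ x = 1 := indicator_of_mem h _
              linarith [hχ0 y]
            · have : χ y = 1 := indicator_of_mem h _
              linarith [hχ0 x]
          have hL0 : 0 ≤ L := by linarith [hζ.one_le]
          have h2 := hζ.div_kernel_le (s := s) hs hp1.le hpm' x y
          rw [Real.mul_rpow (by linarith) (abs_nonneg _), mul_div_assoc]
          calc (1 + T) ^ p x y * (|ζ x - ζ y| ^ p x y / ‖x - y‖ ^ ((n : ℝ) + s * p x y))
              ≤ (1 + T) ^ (m : ℝ) * (L ^ (m : ℝ) * kernelMajorant s (x - y)) := by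
                gcongr
            _ = (1 + T) ^ (m : ℝ) * L ^ (m : ℝ) * (1 * kernelMajorant s (x - y)) := by ring
            _ ≤ (1 + T) ^ (m : ℝ) * L ^ (m : ℝ) * ((χ x + χ y) * kernelMajorant s (x - y)) := by
                gcongr
            _ = _ := by ring
        · push Not at hxy
          rw [hζ.eq_zero x hxy.1, hζ.eq_zero y hxy.2, sub_zero, abs_zero, mul_zero,
            Real.zero_rpow (by linarith), zero_div]
          have := hχ0 x
          have := hχ0 y
          have := hζ.one_le
          positivity
      have hdiff : |φ x - φ y| ≤ |w x - w y| + (1 + T) * |ζ x - ζ y| := by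
        refine (abs_min_mul_sub_min_mul_le (excess_nonneg _ _) hT
          (hζ.nonneg x) (hζ.le_one x)).trans ?_
        exact add_le_add (abs_excess_sub_le _ _ _) (mul_le_mul_of_nonneg_right
          ((min_le_right _ _).trans (by linarith)) (abs_nonneg _))
      simp only
      calc energyDensity s p φ x y
          ≤ 2 ^ p x y * (|w x - w y| ^ p x y + ((1 + T) * |ζ x - ζ y|) ^ p x y)
              / ‖x - y‖ ^ ((n : ℝ) + s * p x y) := by
            unfold energyDensity
            gcongr
            refine (Real.rpow_le_rpow (abs_nonneg _) hdiff (by linarith)).trans ?_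
            exact add_rpow_le_two_rpow_mul (abs_nonneg _) (by positivity) (by linarith)
        _ = 2 ^ p x y * (energyDensity s p w x y +
              ((1 + T) * |ζ x - ζ y|) ^ p x y / ‖x - y‖ ^ ((n : ℝ) + s * p x y)) := by
            unfold energyDensity; ring
        _ ≤ _ := by
            have := energyDensity_nonneg s p w x y
            gcongr
            norm_num
    have hfin := hint.2
    rw [hasFiniteIntegral_iff_ofReal (Eventually.of_forall fun z => energyDensity_nonneg _ _ _ _ _),
      Measure.volume_eq_prod,
      lintegral_prod _ (measurable_energyDensity hpm hφm).ennreal_ofReal.aemeasurable] at hfin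
    exact hfin

/-- The integrand of the nonlocal tail of `w` at `x`. -/
def tailIntegrand {n : ℕ} (s : ℝ) (p : Rn n → Rn n → ℝ) (w : Rn n → ℝ) (x y : Rn n) : ℝ :=
  max (w y) 0 ^ (p x y - 1) / ‖x - y‖ ^ ((n : ℝ) + s * p x y)

lemma tailIntegrand_nonneg {n : ℕ} (s : ℝ) (p : Rn n → Rn n → ℝ) (w : Rn n → ℝ) (x y : Rn n) :
    0 ≤ tailIntegrand s p w x y :=
  div_nonneg (Real.rpow_nonneg (le_max_right _ _) _) (by positivity)

lemma neg_max_rpow_mul_le {a b c p : ℝ} (hp : 1 < p) (hc : 0 ≤ c) (hac : c ≠ 0 → 0 ≤ a) :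
    -(max b 0 ^ (p - 1) * c) ≤ |a - b| ^ (p - 2) * (a - b) * c := by
  rcases eq_or_ne c 0 with rfl | hc0
  · simp
  have ha := hac hc0
  have hm : 0 ≤ max b 0 ^ (p - 1) := Real.rpow_nonneg (le_max_right _ _) _
  rcases le_or_gt b a with h | h
  · have : 0 ≤ |a - b| ^ (p - 2) * (a - b) := mul_nonneg (by positivity) (by linarith)
    nlinarith [mul_nonneg this hc, mul_nonneg hm hc]
  · have h1 : |a - b| ^ (p - 2) * (a - b) = -(b - a) ^ (p - 1) := by
      rw [abs_sub_comm, ← abs_rpow_sub_two_mul_of_pos (sub_pos.2 h)]; ring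
    have h2 : (b - a) ^ (p - 1) ≤ max b 0 ^ (p - 1) :=
      Real.rpow_le_rpow (by linarith) (le_trans (by linarith) (le_max_left _ _)) (by linarith)
    rw [h1]
    nlinarith

lemma indicator_weakIntegrand_le {n : ℕ} {s : ℝ} {p : Rn n → Rn n → ℝ} (hp : ∀ x y, 1 < p x y)
    (hps : ∀ x y, p x y = p y x) {w φ : Rn n → ℝ} {B : Set (Rn n)} (hφ0 : ∀ x, 0 ≤ φ x)
    (hφB : ∀ x, x ∉ B → φ x = 0) (hφw : ∀ x, φ x ≠ 0 → 0 ≤ w x) (z : Rn n × Rn n) :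
    (B ×ˢ B).indicator (weakIntegrand s p w φ) z ≤ weakIntegrand s p w φ z
      + φ z.1 * Bᶜ.indicator (tailIntegrand s p w z.1) z.2
      + φ z.2 * Bᶜ.indicator (tailIntegrand s p w z.2) z.1 := by
  obtain ⟨x, y⟩ := z
  have hk : 0 ≤ ‖x - y‖ ^ ((n : ℝ) + s * p x y) := by positivity
  by_cases hx : x ∈ B <;> by_cases hy : y ∈ B
  · simp [hx, hy]
  · have h := div_le_div_of_nonneg_right
      (neg_max_rpow_mul_le (b := w y) (hp x y) (hφ0 x) (hφw x)) hk
    simp only [hx, hy, hφB y hy, indicator_of_notMem, indicator_of_mem, mem_prod, mem_compl_iff,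
      not_true_eq_false, not_false_eq_true, and_false, weakIntegrand, tailIntegrand]
    rw [sub_zero]
    have e : φ x * (max (w y) 0 ^ (p x y - 1) / ‖x - y‖ ^ ((n : ℝ) + s * p x y)) =
      -(-(max (w y) 0 ^ (p x y - 1) * φ x) / ‖x - y‖ ^ ((n : ℝ) + s * p x y)) := by ring
    linarith
  · have h := div_le_div_of_nonneg_right
      (neg_max_rpow_mul_le (b := w x) (hp x y) (hφ0 y) (hφw y)) hk
    simp only [hx, hy, hφB x hx, indicator_of_notMem, indicator_of_mem, mem_prod, mem_compl_iff,
      not_true_eq_false, not_false_eq_true, false_and, weakIntegrand, tailIntegrand]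
    rw [norm_sub_rev y x, hps y x]
    have e : φ y * (max (w x) 0 ^ (p x y - 1) / ‖x - y‖ ^ ((n : ℝ) + s * p x y)) =
      -(-(max (w x) 0 ^ (p x y - 1) * φ y) / ‖x - y‖ ^ ((n : ℝ) + s * p x y)) := by ring
    have e2 : |w x - w y| ^ (p x y - 2) * (w x - w y) * (0 - φ y) =
        |w y - w x| ^ (p x y - 2) * (w y - w x) * φ y := by
      rw [abs_sub_comm]; ring
    rw [e2]
    linarith
  · simp [hx, hy, hφB x hx, hφB y hy, weakIntegrand]

lemma integral_mul_tailIntegrand_le {n : ℕ} {s A : ℝ} {p : Rn n → Rn n → ℝ}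
    (hpm : Measurable fun z : Rn n × Rn n => p z.1 z.2) {w φ : Rn n → ℝ} (hw : Measurable w)
    (hφm : Measurable φ) {B B₂ : Set (Rn n)} (hB : MeasurableSet B) (hφ0 : ∀ x, 0 ≤ φ x)
    (hφB : ∀ x, x ∉ B₂ → φ x = 0) (hφ : Integrable φ) (hA : 0 ≤ A)
    (htail : ∀ x ∈ B₂, ∫⁻ y in Bᶜ, ENNReal.ofReal (tailIntegrand s p w x y) ≤ ENNReal.ofReal A) :
    Integrable (fun z : Rn n × Rn n => φ z.1 * Bᶜ.indicator (tailIntegrand s p w z.1) z.2) ∧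
      ∫ z : Rn n × Rn n, φ z.1 * Bᶜ.indicator (tailIntegrand s p w z.1) z.2 ≤ A * ∫ x, φ x := by
  have hm : Measurable fun z : Rn n × Rn n =>
      φ z.1 * Bᶜ.indicator (tailIntegrand s p w z.1) z.2 := by
    have h1 : Measurable fun z : Rn n × Rn n => tailIntegrand s p w z.1 z.2 := by
      unfold tailIntegrand
      fun_prop
    have h2 : (fun z : Rn n × Rn n => Bᶜ.indicator (tailIntegrand s p w z.1) z.2) =
        (Prod.snd ⁻¹' Bᶜ).indicator fun z : Rn n × Rn n => tailIntegrand s p w z.1 z.2 := by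
      funext z
      by_cases hz : z.2 ∈ Bᶜ
      · rw [indicator_of_mem hz, indicator_of_mem (show z ∈ Prod.snd ⁻¹' Bᶜ from hz)]
      · rw [indicator_of_notMem hz, indicator_of_notMem (show z ∉ Prod.snd ⁻¹' Bᶜ from hz)]
    refine (hφm.comp measurable_fst).mul ?_
    rw [h2]
    exact h1.indicator (measurable_snd hB.compl)
  have hnn : ∀ z : Rn n × Rn n, 0 ≤ φ z.1 * Bᶜ.indicator (tailIntegrand s p w z.1) z.2 :=
    fun z => mul_nonneg (hφ0 _) (indicator_nonneg (fun y _ => tailIntegrand_nonneg _ _ _ _ _) _)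
  have hl : ∫⁻ z : Rn n × Rn n,
      ENNReal.ofReal (φ z.1 * Bᶜ.indicator (tailIntegrand s p w z.1) z.2) ≤
      ENNReal.ofReal (A * ∫ x, φ x) := by
    rw [Measure.volume_eq_prod, lintegral_prod _ hm.ennreal_ofReal.aemeasurable,
      ENNReal.ofReal_mul hA, ofReal_integral_eq_lintegral_ofReal hφ (Eventually.of_forall hφ0),
      ← lintegral_const_mul' _ _ ENNReal.ofReal_ne_top]
    refine lintegral_mono fun x => ?_
    simp only
    simp_rw [ENNReal.ofReal_mul (hφ0 x)]
    rw [lintegral_const_mul' _ _ ENNReal.ofReal_ne_top, mul_comm]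
    by_cases hx : x ∈ B₂
    · gcongr
      refine le_trans (le_of_eq ?_) (htail x hx)
      rw [← lintegral_indicator hB.compl]
      congr 1
      funext y
      by_cases hy : y ∈ Bᶜ
      · rw [indicator_of_mem hy, indicator_of_mem hy]
      · rw [indicator_of_notMem hy, indicator_of_notMem hy, ENNReal.ofReal_zero]
    · rw [hφB x hx]; simp
  have hint : Integrable (fun z : Rn n × Rn n =>
      φ z.1 * Bᶜ.indicator (tailIntegrand s p w z.1) z.2) := by
    refine ⟨hm.aestronglyMeasurable, ?_⟩
    rw [hasFiniteIntegral_iff_ofReal (Eventually.of_forall hnn)]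
    exact hl.trans_lt ENNReal.ofReal_lt_top
  refine ⟨hint, ?_⟩
  rw [← ofReal_integral_eq_lintegral_ofReal hint (Eventually.of_forall hnn)] at hl
  exact (ENNReal.ofReal_le_ofReal_iff (mul_nonneg hA (integral_nonneg hφ0))).1 hl

/-- `v ^ P` plus the indicator of `v > 0`, the majorant of all powers `v ^ p` with `0 < p ≤ P`. -/
def powerMajorant (P v : ℝ) : ℝ := v ^ P + if 0 < v then 1 else 0

lemma powerMajorant_nonneg {P v : ℝ} (hv : 0 ≤ v) : 0 ≤ powerMajorant P v := by
  unfold powerMajorant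
  split_ifs <;> positivity

/-- Nonlocal Caccioppoli estimate for the excess of a subsolution over a level. -/
lemma caccioppoli {n : ℕ} (hn : 1 ≤ n) {s : ℝ} (hs : s ∈ Set.Ioo (0 : ℝ) 1)
    {p : Rn n → Rn n → ℝ} (hpm : Measurable fun z : Rn n × Rn n => p z.1 z.2)
    (hps : ∀ x y, p x y = p y x) {m : ℕ} (hp : ∀ x y, 1 < p x y ∧ p x y ≤ m)
    {w η : Rn n → ℝ} (hw : MemW s p w) {x₀ : Rn n} {ρ ρ₂ ρ₃ L P ℓ A : ℝ}
    (hρ₂ : ρ₂ ≤ ρ) (hρ₃ : ρ₃ ≤ ρ₂)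
    (hsub : ∀ φ, MemW s p φ → (∀ x, 0 ≤ φ x) → (∀ x, x ∉ ball x₀ ρ₂ → φ x = 0) →
      ∫ z, weakIntegrand s p w φ z ≤ 0)
    (hη : IsCutoff η (ball x₀ ρ₂) L) (hη1 : ∀ x ∈ ball x₀ ρ₃, η x = 1)
    (hP : ∀ x ∈ ball x₀ ρ, ∀ y ∈ ball x₀ ρ, p x y ≤ P) (hP1 : 1 ≤ P) (hℓ : 0 ≤ ℓ)
    (hA : 0 ≤ A) (htail : ∀ x ∈ ball x₀ ρ₂, ∫⁻ y in (ball x₀ ρ)ᶜ,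
      ENNReal.ofReal (tailIntegrand s p w x y) ≤ ENNReal.ofReal A)
    (hV : IntegrableOn (fun x => powerMajorant P (excess ℓ (w x))) (ball x₀ ρ)) :
    ∫⁻ x in ball x₀ ρ₃, ∫⁻ y in ball x₀ ρ₃,
        ENNReal.ofReal (energyDensity s p (fun x => excess ℓ (w x)) x y) ≤
      ENNReal.ofReal ((4 * ((2 * m) ^ (m : ℝ) * L ^ (m : ℝ) * ∫ x : Rn n, kernelMajorant s x)
        + 4 * A) * ∫ x in ball x₀ ρ, powerMajorant P (excess ℓ (w x))) := by
  set B := ball x₀ ρ with hB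
  set v : Rn n → ℝ := fun x => excess ℓ (w x) with hv
  have hv0 : ∀ x, 0 ≤ v x := fun x => excess_nonneg _ _
  have hvm : Measurable v := (hw.1.sub_const ℓ).max measurable_const
  have hm1 : 1 ≤ m := by
    have : (1 : ℝ) < m := (hp x₀ x₀).1.trans_le (hp x₀ x₀).2
    exact_mod_cast this.le
  have hm1' : (1 : ℝ) ≤ m := by exact_mod_cast hm1
  set ζ : Rn n → ℝ := fun x => η x ^ m with hζ
  have hζc : IsCutoff ζ (ball x₀ ρ₂) (m * L) := hη.pow hm1
  set V : Rn n → ℝ := B.indicator fun x => powerMajorant P (v x) with hVdef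
  have hVint : Integrable V := (integrable_indicator_iff measurableSet_ball).2 hV
  have hV0 : ∀ x, 0 ≤ V x :=
    fun x => indicator_nonneg (fun y _ => powerMajorant_nonneg (hv0 y)) x
  have hVI : ∫ x in B, powerMajorant P (v x) = ∫ x, V x :=
    (integral_indicator measurableSet_ball).symm
  have hvV : ∀ x ∈ B, ∀ q : ℝ, 0 < q → q ≤ P → v x ^ q ≤ V x := by
    intro x hx q hq hqP
    rw [hVdef, indicator_of_mem hx]
    exact rpow_le_rpow_add_ite (hv0 x) hq hqP
  set G0 := ∫ x : Rn n, kernelMajorant s x with hG0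
  have hL1 := hη.one_le
  -- the truncated test functions
  set φ : ℕ → Rn n → ℝ := fun T x => min (v x) (T : ℝ) * ζ x with hφ
  have hφW : ∀ T, MemW s p (φ T) := fun T =>
    memW_min_excess_mul hn hs hpm hp hw hζc ℓ (Nat.cast_nonneg T)
  have hφ0 : ∀ T x, 0 ≤ φ T x := fun T x =>
    mul_nonneg (le_min (hv0 x) (Nat.cast_nonneg T)) (hζc.nonneg x)
  have hφB₂ : ∀ T x, x ∉ ball x₀ ρ₂ → φ T x = 0 := fun T x hx => by
    simp only [hφ, hζc.eq_zero x hx, mul_zero]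
  have hφB : ∀ T x, x ∉ B → φ T x = 0 := fun T x hx =>
    hφB₂ T x fun h => hx (ball_subset_ball hρ₂ h)
  have hφV : ∀ T x, φ T x ≤ V x := by
    intro T x
    by_cases hx : x ∈ B
    · calc φ T x ≤ v x * 1 :=
            mul_le_mul (min_le_left _ _) (hζc.le_one x) (hζc.nonneg x) (hv0 x)
        _ = v x ^ (1 : ℝ) := by rw [mul_one, Real.rpow_one]
        _ ≤ V x := hvV x hx 1 one_pos hP1
    · rw [hφB T x hx]; exact hV0 x
  have hφint : ∀ T, Integrable (φ T) := fun T =>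
    hVint.mono' (hφW T).1.aestronglyMeasurable (Eventually.of_forall fun x => by
      rw [Real.norm_of_nonneg (hφ0 T x)]; exact hφV T x)
  have hφw : ∀ T x, φ T x ≠ 0 → 0 ≤ w x := by
    intro T x h
    by_contra! hw0
    apply h
    have : v x = 0 := max_eq_right (by linarith)
    simp [hφ, this]
  set f : ℕ → Rn n × Rn n → ℝ := fun T => (B ×ˢ B).indicator (weakIntegrand s p w (φ T)) with hf
  set f' : Rn n × Rn n → ℝ :=
    (B ×ˢ B).indicator (weakIntegrand s p w fun x => v x * ζ x) with hf'
  have hBB : MeasurableSet (B ×ˢ B) := measurableSet_ball.prod measurableSet_ball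
  have hfm : ∀ T, Measurable (f T) := fun T =>
    (measurable_weakIntegrand hpm hw.1 (hφW T).1).indicator hBB
  have hf'm : Measurable f' :=
    (measurable_weakIntegrand hpm hw.1 (hvm.mul hζc.measurable)).indicator hBB
  set bound : Rn n × Rn n → ℝ := fun z => 3 * energyDensity s p w z.1 z.2 +
    (m * L) ^ (m : ℝ) * (V z.2 * kernelMajorant s (z.1 - z.2)) with hbound
  have hboundint : Integrable bound :=
    ((integrable_energyDensity hpm hw).const_mul 3).add
      ((integrable_mul_kernelMajorant_snd hn hs hVint).1.const_mul _)
  have hfbound : ∀ T z, ‖f T z‖ ≤ bound z := by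
    rintro T ⟨x, y⟩
    have hG := kernelMajorant_nonneg s (x - y)
    have hd := energyDensity_nonneg s p w x y
    by_cases hz : (x, y) ∈ B ×ˢ B
    · simp only [hf, indicator_of_mem hz, Real.norm_eq_abs]
      rw [abs_weakIntegrand w (φ T) fun x y => (hp x y).1]
      simp only [hbound]
      obtain ⟨hp1, hpm'⟩ := hp x y
      have hk : 0 ≤ ‖x - y‖ ^ ((n : ℝ) + s * p x y) := by positivity
      have hT0 : 0 ≤ min (v y) (T : ℝ) := le_min (hv0 y) (Nat.cast_nonneg T)
      have h1 : |φ T x - φ T y| ≤ |w x - w y| + v y * |ζ x - ζ y| := by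
        refine (abs_min_mul_sub_min_mul_le (hv0 y) (Nat.cast_nonneg T)
          (hζc.nonneg x) (hζc.le_one x)).trans (add_le_add (abs_excess_sub_le _ _ _)
            (mul_le_mul_of_nonneg_right (min_le_left _ _) (abs_nonneg _)))
      have h2 : |w x - w y| ^ (p x y - 1) * |φ T x - φ T y| ≤
          3 * |w x - w y| ^ p x y + v y ^ p x y * |ζ x - ζ y| ^ p x y := by
        have e1 := rpow_sub_one_mul_le (abs_nonneg (w x - w y)) (abs_nonneg (w x - w y)) hp1
        have e2 := rpow_sub_one_mul_le (abs_nonneg (w x - w y))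
          (mul_nonneg (hv0 y) (abs_nonneg (ζ x - ζ y))) hp1
        rw [Real.mul_rpow (hv0 y) (abs_nonneg _)] at e2
        have e3 : |w x - w y| ^ (p x y - 1) * |φ T x - φ T y| ≤
            |w x - w y| ^ (p x y - 1) * (|w x - w y| + v y * |ζ x - ζ y|) := by gcongr
        rw [mul_add] at e3
        linarith
      have h3 := hvV y hz.2 (p x y) (by linarith) (hP x hz.1 y hz.2)
      have h4 := hζc.div_kernel_le hs hp1.le hpm' x y
      have h5 : 0 ≤ |ζ x - ζ y| ^ p x y / ‖x - y‖ ^ ((n : ℝ) + s * p x y) := by positivity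
      calc |w x - w y| ^ (p x y - 1) * |φ T x - φ T y| / ‖x - y‖ ^ ((n : ℝ) + s * p x y)
          ≤ (3 * |w x - w y| ^ p x y + v y ^ p x y * |ζ x - ζ y| ^ p x y)
              / ‖x - y‖ ^ ((n : ℝ) + s * p x y) := by gcongr
        _ = 3 * energyDensity s p w x y +
              v y ^ p x y * (|ζ x - ζ y| ^ p x y / ‖x - y‖ ^ ((n : ℝ) + s * p x y)) := by
            unfold energyDensity; ring
        _ ≤ 3 * energyDensity s p w x y +
              V y * ((m * L) ^ (m : ℝ) * kernelMajorant s (x - y)) := by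
            have := hV0 y
            gcongr
        _ = _ := by ring
    · simp only [hf, indicator_of_notMem hz, norm_zero, hbound]
      have := hV0 y
      positivity
  have hlim : ∀ z, Tendsto (fun T => f T z) atTop (𝓝 (f' z)) := by
    intro z
    refine tendsto_const_nhds.congr' ?_
    filter_upwards [eventually_ge_atTop ⌈max (v z.1) (v z.2)⌉₊] with T hT
    have hT' : max (v z.1) (v z.2) ≤ T := Nat.ceil_le.1 hT
    have e1 : φ T z.1 = v z.1 * ζ z.1 := by
      simp only [hφ]; rw [min_eq_left ((le_max_left _ _).trans hT')]
    have e2 : φ T z.2 = v z.2 * ζ z.2 := by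
      simp only [hφ]; rw [min_eq_left ((le_max_right _ _).trans hT')]
    by_cases hz : z ∈ B ×ˢ B
    · simp only [hf, hf', indicator_of_mem hz, weakIntegrand, e1, e2]
    · simp only [hf, hf', indicator_of_notMem hz]
  have hf'int : Integrable f' := hboundint.mono' hf'm.aestronglyMeasurable
    (Eventually.of_forall fun z => le_of_tendsto' (hlim z).norm fun T => hfbound T z)
  have hfint : ∀ T, Integrable (f T) := fun T => hboundint.mono' (hfm T).aestronglyMeasurable
    (Eventually.of_forall (hfbound T))
  have hfle : ∀ T, ∫ z, f T z ≤ 2 * A * ∫ x, V x := by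
    intro T
    obtain ⟨hH, hHle⟩ := integral_mul_tailIntegrand_le hpm hw.1 (hφW T).1
      (measurableSet_ball (x := x₀) (ε := ρ)) (hφ0 T) (hφB₂ T) (hφint T) hA htail
    have hH' : Integrable fun z : Rn n × Rn n =>
        φ T z.2 * Bᶜ.indicator (tailIntegrand s p w z.2) z.1 := by
      rw [Measure.volume_eq_prod] at hH ⊢
      exact hH.swap
    have hHe : ∫ z : Rn n × Rn n, φ T z.2 * Bᶜ.indicator (tailIntegrand s p w z.2) z.1 =
        ∫ z : Rn n × Rn n, φ T z.1 * Bᶜ.indicator (tailIntegrand s p w z.1) z.2 := by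
      rw [Measure.volume_eq_prod]
      exact integral_prod_swap
        (fun z : Rn n × Rn n => φ T z.1 * Bᶜ.indicator (tailIntegrand s p w z.1) z.2)
    have hI := integrable_weakIntegrand hpm (fun x y => (hp x y).1) hw (hφW T)
    have hle : ∫ z, f T z ≤ ∫ z : Rn n × Rn n, (weakIntegrand s p w (φ T) z
        + φ T z.1 * Bᶜ.indicator (tailIntegrand s p w z.1) z.2
        + φ T z.2 * Bᶜ.indicator (tailIntegrand s p w z.2) z.1) :=
      integral_mono (hfint T) ((hI.add hH).add hH') fun z =>
        indicator_weakIntegrand_le (fun x y => (hp x y).1) hps (hφ0 T) (hφB T) (hφw T) z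
    have hadd := (integral_add (hI.add hH) hH').trans (congrArg₂ (· + ·) (integral_add hI hH) hHe)
    replace hle := hle.trans_eq hadd
    have h1 := hsub (φ T) (hφW T) (hφ0 T) (hφB₂ T)
    have h2 : A * ∫ x, φ T x ≤ A * ∫ x, V x :=
      mul_le_mul_of_nonneg_left (integral_mono (hφint T) hVint (hφV T)) hA
    linarith
  have hf'le : ∫ z, f' z ≤ 2 * A * ∫ x, V x :=
    le_of_tendsto' (tendsto_integral_of_dominated_convergence bound
      (fun T => (hfm T).aestronglyMeasurable) hboundint
      (fun T => Eventually.of_forall (hfbound T)) (Eventually.of_forall hlim)) hfle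
  -- the pointwise inequality
  set c : ℝ := (2 * m) ^ (m : ℝ) * L ^ (m : ℝ) with hc
  set R : Rn n × Rn n → ℝ := fun z => c * (V z.1 * kernelMajorant s (z.1 - z.2) +
    V z.2 * kernelMajorant s (z.1 - z.2)) with hR
  obtain ⟨hR1, hR1e⟩ := integrable_mul_kernelMajorant hn hs hVint
  obtain ⟨hR2, hR2e⟩ := integrable_mul_kernelMajorant_snd hn hs hVint
  have hRint : Integrable R := (hR1.add hR2).const_mul c
  have hRe : ∫ z, R z = c * (2 * ((∫ x, V x) * G0)) := by
    rw [hR, integral_const_mul, integral_add hR1 hR2, hR1e, hR2e]; ring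
  set B₃ := ball x₀ ρ₃ with hB₃
  have hB₃B : B₃ ⊆ B := ball_subset_ball (hρ₃.trans hρ₂)
  have hpt : ∀ z : Rn n × Rn n,
      (B₃ ×ˢ B₃).indicator (fun z => energyDensity s p v z.1 z.2) z ≤ 2 * (f' z + R z) := by
    rintro ⟨x, y⟩
    have hG := kernelMajorant_nonneg s (x - y)
    have hk : 0 ≤ ‖x - y‖ ^ ((n : ℝ) + s * p x y) := by positivity
    by_cases hz : (x, y) ∈ B ×ˢ B
    · obtain ⟨hp1, hpm'⟩ := hp x y
      have h1 := div_le_div_of_nonneg_right (caccioppoli_pointwise (a := w x) (b := w y) (ℓ := ℓ)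
        hp1 hpm' (hη.nonneg x) (hη.le_one x) (hη.nonneg y) (hη.le_one y)) hk
      have h2 : (2 * m : ℝ) ^ p x y * ((v x ^ p x y + v y ^ p x y) * |η x - η y| ^ p x y)
          / ‖x - y‖ ^ ((n : ℝ) + s * p x y) ≤ R (x, y) := by
        have e1 := hvV x hz.1 (p x y) (by linarith) (hP x hz.1 y hz.2)
        have e2 := hvV y hz.2 (p x y) (by linarith) (hP x hz.1 y hz.2)
        have e3 := hη.div_kernel_le hs hp1.le hpm' x y
        have e4 : (2 * m : ℝ) ^ p x y ≤ (2 * m) ^ (m : ℝ) :=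
          Real.rpow_le_rpow_of_exponent_le (by linarith) hpm'
        have e5 := Real.rpow_nonneg (hv0 x) (p x y)
        have e6 := Real.rpow_nonneg (hv0 y) (p x y)
        calc _ = (2 * m : ℝ) ^ p x y * ((v x ^ p x y + v y ^ p x y) *
              (|η x - η y| ^ p x y / ‖x - y‖ ^ ((n : ℝ) + s * p x y))) := by ring
          _ ≤ (2 * m) ^ (m : ℝ) * ((V x + V y) * (L ^ (m : ℝ) * kernelMajorant s (x - y))) := by
              have := hV0 x
              have := hV0 y
              gcongr
          _ = R (x, y) := by simp only [hR, hc]; ring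
      rw [add_div] at h1
      have h3 : f' (x, y) = |w x - w y| ^ (p x y - 2) * (w x - w y) *
          (excess ℓ (w x) * η x ^ m - excess ℓ (w y) * η y ^ m)
            / ‖x - y‖ ^ ((n : ℝ) + s * p x y) := by
        simp only [hf', indicator_of_mem hz, weakIntegrand, hv, hζ]
      rw [← h3] at h1
      have h4 : (B₃ ×ˢ B₃).indicator (fun z => energyDensity s p v z.1 z.2) (x, y) ≤
          2 * (|excess ℓ (w x) - excess ℓ (w y)| ^ p x y * (1 / 2 * min (η x ^ m) (η y ^ m))
            / ‖x - y‖ ^ ((n : ℝ) + s * p x y)) := by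
        by_cases hz₃ : (x, y) ∈ B₃ ×ˢ B₃
        · rw [indicator_of_mem hz₃, hη1 x hz₃.1, hη1 y hz₃.2]
          simp only [energyDensity, hv, one_pow, min_self]
          exact le_of_eq (by ring)
        · rw [indicator_of_notMem hz₃]
          have : 0 ≤ min (η x ^ m) (η y ^ m) :=
            le_min (pow_nonneg (hη.nonneg x) m) (pow_nonneg (hη.nonneg y) m)
          positivity
      linarith
    · have hz₃ : (x, y) ∉ B₃ ×ˢ B₃ := fun h => hz ⟨hB₃B h.1, hB₃B h.2⟩
      rw [indicator_of_notMem hz₃, hf', indicator_of_notMem hz]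
      have := hV0 x
      have := hV0 y
      simp only [hR]
      positivity
  have hB₃B₃ : MeasurableSet (B₃ ×ˢ B₃) := measurableSet_ball.prod measurableSet_ball
  have hdm : Measurable fun z : Rn n × Rn n => energyDensity s p v z.1 z.2 :=
    measurable_energyDensity hpm hvm
  have hsumint : Integrable fun z => 2 * (f' z + R z) := (hf'int.add hRint).const_mul 2
  have hnn : ∀ z, 0 ≤ 2 * (f' z + R z) := fun z =>
    (indicator_nonneg (fun z _ => energyDensity_nonneg _ _ _ _ _) z).trans (hpt z)
  calc ∫⁻ x in B₃, ∫⁻ y in B₃, ENNReal.ofReal (energyDensity s p v x y)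
      = ∫⁻ z in B₃ ×ˢ B₃, ENNReal.ofReal (energyDensity s p v z.1 z.2) := by
        rw [Measure.volume_eq_prod, ← Measure.prod_restrict,
          lintegral_prod _ hdm.ennreal_ofReal.aemeasurable]
    _ = ∫⁻ z, ENNReal.ofReal
          ((B₃ ×ˢ B₃).indicator (fun z => energyDensity s p v z.1 z.2) z) := by
        rw [← lintegral_indicator hB₃B₃]
        congr 1
        funext z
        by_cases hz : z ∈ B₃ ×ˢ B₃
        · rw [indicator_of_mem hz, indicator_of_mem hz]
        · rw [indicator_of_notMem hz, indicator_of_notMem hz, ENNReal.ofReal_zero]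
    _ ≤ ∫⁻ z, ENNReal.ofReal (2 * (f' z + R z)) :=
        lintegral_mono fun z => ENNReal.ofReal_le_ofReal (hpt z)
    _ = ENNReal.ofReal (∫ z, 2 * (f' z + R z)) :=
        (ofReal_integral_eq_lintegral_ofReal hsumint (Eventually.of_forall hnn)).symm
    _ ≤ _ := by
        refine ENNReal.ofReal_le_ofReal ?_
        rw [integral_const_mul, integral_add hf'int hRint, hRe, hVI]
        linarith

lemma one_add_norm_rpow_le {n : ℕ} {s q D g : ℝ} {m : ℕ} (hs : s ∈ Set.Ioo (0 : ℝ) 1)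
    (hq : 0 ≤ q) (hqm : q ≤ m) (hD : 1 ≤ D) (hg : 0 < g) (hg1 : g ≤ 1) {x y : Rn n}
    (hx : ‖x‖ ≤ D) (hxy : g ≤ ‖x - y‖) :
    1 + ‖y‖ ^ ((n : ℝ) + s * q) ≤
      2 * ((D + 1) / g) ^ ((n : ℝ) + m) * ‖x - y‖ ^ ((n : ℝ) + s * q) := by
  set d := ‖x - y‖ with hd
  have hd0 : 0 < d := hg.trans_le hxy
  set κ := (D + 1) / g with hκ
  have hκ1 : 1 ≤ κ := by rw [hκ, le_div_iff₀ hg]; linarith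
  have he : 0 ≤ (n : ℝ) + s * q := by have := hs.1; positivity
  have hem : (n : ℝ) + s * q ≤ n + m := by nlinarith [hs.1, hs.2]
  have hκd : D + 1 ≤ κ * d := by
    rw [hκ, div_mul_eq_mul_div, le_div_iff₀ hg]
    nlinarith
  have hy : ‖y‖ ≤ κ * d := by
    have h1 : ‖y‖ ≤ D + d := by
      have := norm_sub_le x (x - y)
      rw [sub_sub_cancel] at this
      linarith
    have h2 : D + d ≤ κ * d := by
      have h3 : D / g * g ≤ D / g * d := by gcongr
      have h4 : d ≤ 1 / g * d := by
        have : 1 ≤ 1 / g := by rw [le_div_iff₀ hg]; linarith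
        nlinarith
      rw [div_mul_cancel₀ _ hg.ne'] at h3
      have : κ * d = D / g * d + 1 / g * d := by rw [hκ]; ring
      linarith
    exact h1.trans h2
  have h1 : (κ * d) ^ ((n : ℝ) + s * q) ≤ κ ^ ((n : ℝ) + m) * d ^ ((n : ℝ) + s * q) := by
    rw [Real.mul_rpow (by positivity) hd0.le]
    gcongr
  have h2 : ‖y‖ ^ ((n : ℝ) + s * q) ≤ (κ * d) ^ ((n : ℝ) + s * q) := by gcongr
  have h3 : 1 ≤ (κ * d) ^ ((n : ℝ) + s * q) := Real.one_le_rpow (by linarith) he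
  linarith

lemma setLIntegral_tailIntegrand_le {n : ℕ} {s D g M : ℝ} {m : ℕ} (hs : s ∈ Set.Ioo (0 : ℝ) 1)
    {p : Rn n → Rn n → ℝ} (hp : ∀ x y, 1 < p x y ∧ p x y ≤ m) {w : Rn n → ℝ} (hD : 1 ≤ D)
    (hg : 0 < g) (hg1 : g ≤ 1) {x : Rn n} {B : Set (Rn n)} (hB : MeasurableSet B)
    (hx : ‖x‖ ≤ D) (hxB : ∀ y, y ∉ B → g ≤ ‖x - y‖)
    (htail : ∫⁻ y, ENNReal.ofReal (max (w y) 0 ^ (p x y - 1) / (1 + ‖y‖ ^ ((n : ℝ) + s * p x y)))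
      ≤ ENNReal.ofReal M) :
    ∫⁻ y in Bᶜ, ENNReal.ofReal (tailIntegrand s p w x y) ≤
      ENNReal.ofReal (2 * ((D + 1) / g) ^ ((n : ℝ) + m) * M) := by
  have hc : 0 ≤ 2 * ((D + 1) / g) ^ ((n : ℝ) + m) := by positivity
  calc ∫⁻ y in Bᶜ, ENNReal.ofReal (tailIntegrand s p w x y)
      ≤ ∫⁻ y in Bᶜ, ENNReal.ofReal (2 * ((D + 1) / g) ^ ((n : ℝ) + m)) *
          ENNReal.ofReal (max (w y) 0 ^ (p x y - 1) / (1 + ‖y‖ ^ ((n : ℝ) + s * p x y))) := by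
        refine setLIntegral_mono' hB.compl fun y hy => ?_
        rw [← ENNReal.ofReal_mul hc]
        refine ENNReal.ofReal_le_ofReal ?_
        obtain ⟨hp1, hpm⟩ := hp x y
        have hk := one_add_norm_rpow_le hs (by linarith) hpm hD hg hg1 hx (hxB y hy)
        have hd : 0 < ‖x - y‖ := hg.trans_le (hxB y hy)
        have hm : 0 ≤ max (w y) 0 ^ (p x y - 1) := Real.rpow_nonneg (le_max_right _ _) _
        rw [tailIntegrand, ← mul_div_assoc, div_le_div_iff₀ (by positivity) (by positivity)]
        nlinarith [mul_le_mul_of_nonneg_left hk hm]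
    _ ≤ ∫⁻ y, ENNReal.ofReal (2 * ((D + 1) / g) ^ ((n : ℝ) + m)) *
          ENNReal.ofReal (max (w y) 0 ^ (p x y - 1) / (1 + ‖y‖ ^ ((n : ℝ) + s * p x y))) :=
        setLIntegral_le_lintegral _ _
    _ ≤ _ := by
        rw [lintegral_const_mul' _ _ ENNReal.ofReal_ne_top, ENNReal.ofReal_mul hc]
        gcongr

lemma isCutoff_radial {n : ℕ} (x₀ : Rn n) {ρ₃ ρ₂ : ℝ} (h : ρ₃ < ρ₂) (h1 : ρ₂ - ρ₃ ≤ 1) :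
    IsCutoff (fun x => max 0 (min 1 ((ρ₂ - ‖x - x₀‖) / (ρ₂ - ρ₃)))) (ball x₀ ρ₂)
      (1 / (ρ₂ - ρ₃)) where
  measurable := by fun_prop
  nonneg x := le_max_left _ _
  le_one x := max_le zero_le_one (min_le_left _ _)
  one_le := by rw [le_div_iff₀ (by linarith)]; linarith
  lipschitz x y := by
    have hpos : 0 < ρ₂ - ρ₃ := by linarith
    calc |max 0 (min 1 ((ρ₂ - ‖x - x₀‖) / (ρ₂ - ρ₃))) - max 0 (min 1 ((ρ₂ - ‖y - x₀‖) / (ρ₂ - ρ₃)))|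
        ≤ |min 1 ((ρ₂ - ‖x - x₀‖) / (ρ₂ - ρ₃)) - min 1 ((ρ₂ - ‖y - x₀‖) / (ρ₂ - ρ₃))| := by
          simpa using abs_max_sub_max_le_max 0 (min 1 ((ρ₂ - ‖x - x₀‖) / (ρ₂ - ρ₃))) 0
            (min 1 ((ρ₂ - ‖y - x₀‖) / (ρ₂ - ρ₃)))
      _ ≤ |(ρ₂ - ‖x - x₀‖) / (ρ₂ - ρ₃) - (ρ₂ - ‖y - x₀‖) / (ρ₂ - ρ₃)| := by
          simpa using abs_min_sub_min_le_max 1 ((ρ₂ - ‖x - x₀‖) / (ρ₂ - ρ₃)) 1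
            ((ρ₂ - ‖y - x₀‖) / (ρ₂ - ρ₃))
      _ = 1 / (ρ₂ - ρ₃) * |‖y - x₀‖ - ‖x - x₀‖| := by
          rw [← sub_div, abs_div, abs_of_pos hpos, sub_sub_sub_cancel_left]; ring
      _ ≤ 1 / (ρ₂ - ρ₃) * ‖x - y‖ := by
          gcongr
          refine (abs_norm_sub_norm_le _ _).trans ?_
          rw [sub_sub_sub_cancel_right, norm_sub_rev]
  eq_zero x hx := by
    rw [mem_ball, dist_eq_norm, not_lt] at hx
    refine max_eq_left ((min_le_right _ _).trans ?_)
    exact div_nonpos_of_nonpos_of_nonneg (by linarith) (by linarith)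

lemma radial_cutoff_eq_one {n : ℕ} {x₀ x : Rn n} {ρ₃ ρ₂ : ℝ} (h : ρ₃ < ρ₂)
    (hx : x ∈ ball x₀ ρ₃) : max 0 (min 1 ((ρ₂ - ‖x - x₀‖) / (ρ₂ - ρ₃))) = 1 := by
  rw [mem_ball, dist_eq_norm] at hx
  have : 1 ≤ (ρ₂ - ‖x - x₀‖) / (ρ₂ - ρ₃) := by rw [le_div_iff₀ (by linarith)]; linarith
  rw [min_eq_left this, max_eq_right zero_le_one]

lemma volume_setOf_le_le_of_setLIntegral_rpow_le {n : ℕ} {f : Rn n → ℝ} {B : Set (Rn n)} {P a l : ℝ}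
    (hf : Measurable f) (hP : 0 ≤ P) (hl : 0 < l)
    (h : ∫⁻ x in B, ENNReal.ofReal (f x ^ P) ≤ ENNReal.ofReal a) :
    volume {y | y ∈ B ∧ l ≤ f y} ≤ ENNReal.ofReal (a * l ^ (-P)) := by
  have hlP : 0 < l ^ P := by positivity
  have hset : {y | y ∈ B ∧ l ≤ f y} ⊆ {y | ENNReal.ofReal (l ^ P) ≤ ENNReal.ofReal (f y ^ P)} ∩ B :=
    fun y hy => ⟨ENNReal.ofReal_le_ofReal (Real.rpow_le_rpow hl.le hy.2 hP), hy.1⟩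
  have hm : Measurable fun y => ENNReal.ofReal (f y ^ P) := (hf.pow_const P).ennreal_ofReal
  calc volume {y | y ∈ B ∧ l ≤ f y}
      ≤ volume.restrict B {y | ENNReal.ofReal (l ^ P) ≤ ENNReal.ofReal (f y ^ P)} := by
        rw [Measure.restrict_apply (measurableSet_le measurable_const hm)]
        exact measure_mono hset
    _ ≤ (∫⁻ x in B, ENNReal.ofReal (f x ^ P)) / ENNReal.ofReal (l ^ P) :=
        meas_ge_le_lintegral_div hm.aemeasurable (by simpa using hlP) ENNReal.ofReal_ne_top
    _ ≤ ENNReal.ofReal a / ENNReal.ofReal (l ^ P) := by gcongr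
    _ = ENNReal.ofReal (a * l ^ (-P)) := by
        rw [← ENNReal.ofReal_div_of_pos hlP, Real.rpow_neg hl.le, div_eq_mul_inv]

/-- `∫_B (w - ℓ)₊ ^ P`. -/
def excessMass {n : ℕ} (P : ℝ) (w : Rn n → ℝ) (B : Set (Rn n)) (ℓ : ℝ) : ℝ≥0∞ :=
  ∫⁻ x in B, ENNReal.ofReal (excess ℓ (w x) ^ P)

lemma excessMass_mono {n : ℕ} {P ℓ ℓ' : ℝ} (hP : 0 ≤ P) (w : Rn n → ℝ) {B B' : Set (Rn n)}
    (hB : B ⊆ B') (hℓ : ℓ' ≤ ℓ) : excessMass P w B ℓ ≤ excessMass P w B' ℓ' :=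
  (lintegral_mono fun x => ENNReal.ofReal_le_ofReal
    (Real.rpow_le_rpow (excess_nonneg _ _) (max_le_max (by linarith) le_rfl) hP)).trans
    (lintegral_mono_set hB)

lemma lintegral_powerMajorant_le {n : ℕ} {P a b : ℝ} {v : Rn n → ℝ} {B : Set (Rn n)}
    (hv : Measurable v) (hv0 : ∀ x, 0 ≤ v x) (ha : 0 ≤ a) (hb : 0 ≤ b)
    (h1 : ∫⁻ x in B, ENNReal.ofReal (v x ^ P) ≤ ENNReal.ofReal a)
    (h2 : volume {y | y ∈ B ∧ 0 < v y} ≤ ENNReal.ofReal b) :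
    IntegrableOn (fun x => powerMajorant P (v x)) B ∧
      ∫ x in B, powerMajorant P (v x) ≤ a + b := by
  have hm0 : MeasurableSet {y | 0 < v y} := measurableSet_lt measurable_const hv
  have hm : Measurable fun x => powerMajorant P (v x) :=
    (hv.pow_const P).add (Measurable.ite hm0 measurable_const measurable_const)
  have hnn : ∀ x, 0 ≤ powerMajorant P (v x) := fun x => powerMajorant_nonneg (hv0 x)
  have hle : ∫⁻ x in B, ENNReal.ofReal (powerMajorant P (v x)) ≤ ENNReal.ofReal (a + b) := by
    rw [ENNReal.ofReal_add ha hb]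
    calc ∫⁻ x in B, ENNReal.ofReal (powerMajorant P (v x))
        = ∫⁻ x in B, (ENNReal.ofReal (v x ^ P) + {y | 0 < v y}.indicator (fun _ => 1) x) := by
          refine lintegral_congr fun x => ?_
          rw [powerMajorant]
          by_cases hx : 0 < v x
          · rw [if_pos hx, indicator_of_mem (show x ∈ {y | 0 < v y} from hx),
              ENNReal.ofReal_add (by have := hv0 x; positivity) zero_le_one, ENNReal.ofReal_one]
          · rw [if_neg hx, indicator_of_notMem (show x ∉ {y | 0 < v y} from hx), add_zero, add_zero]
      _ = (∫⁻ x in B, ENNReal.ofReal (v x ^ P)) + volume {y | y ∈ B ∧ 0 < v y} := by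
          rw [lintegral_add_left (hv.pow_const P).ennreal_ofReal, lintegral_indicator_const hm0,
            Measure.restrict_apply hm0, one_mul, inter_comm]
          rfl
      _ ≤ _ := add_le_add h1 h2
  have hint : IntegrableOn (fun x => powerMajorant P (v x)) B := by
    refine ⟨hm.aestronglyMeasurable, ?_⟩
    rw [hasFiniteIntegral_iff_ofReal (Eventually.of_forall hnn)]
    exact hle.trans_lt ENNReal.ofReal_lt_top
  refine ⟨hint, ?_⟩
  rw [← ofReal_integral_eq_lintegral_ofReal hint (Eventually.of_forall hnn)] at hle
  exact (ENNReal.ofReal_le_ofReal_iff (by positivity)).1 hle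

/-- One step of the De Giorgi iteration. -/
lemma excessMass_step {n : ℕ} (hn : 1 ≤ n) {s : ℝ} (hs : s ∈ Set.Ioo (0 : ℝ) 1)
    {p : Rn n → Rn n → ℝ} (hpm : Measurable fun z : Rn n × Rn n => p z.1 z.2)
    (hps : ∀ x y, p x y = p y x) {m : ℕ} (hp : ∀ x y, 1 < p x y ∧ p x y ≤ m)
    {w : Rn n → ℝ} (hw : MemW s p w) {x₀ : Rn n} {R P q D M : ℝ} (hR : R ≤ 1)
    (hsub : ∀ φ, MemW s p φ → (∀ x, 0 ≤ φ x) → (∀ x, x ∉ ball x₀ R → φ x = 0) →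
      ∫ z, weakIntegrand s p w φ z ≤ 0)
    (hq : 1 < q) (hqP : q ≤ P) (hPt : P ≤ q + P * (s * q / n))
    (hpq : ∀ x ∈ ball x₀ R, ∀ y ∈ ball x₀ R, q ≤ p x y ∧ p x y ≤ P)
    (hD : 1 ≤ D) (hRD : ∀ x ∈ ball x₀ R, ‖x‖ ≤ D) (hM : 0 ≤ M)
    (htail : ∀ x ∈ ball x₀ R,
      ∫⁻ y, ENNReal.ofReal (max (w y) 0 ^ (p x y - 1) / (1 + ‖y‖ ^ ((n : ℝ) + s * p x y)))
        ≤ ENNReal.ofReal M) :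
    ∃ C > (0 : ℝ), ∃ N > (0 : ℝ), ∀ ρ g ℓ : ℝ, 0 < g → g ≤ ρ → ρ ≤ R → 0 ≤ ℓ →
      excessMass P w (ball x₀ ρ) ℓ ≠ ⊤ →
      (excessMass P w (ball x₀ (ρ - g)) (ℓ + g)).toReal ≤
        C * (1 / g) ^ N * (excessMass P w (ball x₀ ρ) ℓ).toReal ^ (1 + s * q / n) := by
  obtain ⟨C₂, hC₂, hgain⟩ := setLIntegral_rpow_le_energy hn hs.1 (by linarith : 0 < q)
    (by linarith : 0 < P) hPt
  have hP0 : 0 < P := by linarith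
  have hn0 : (0 : ℝ) < n := by exact_mod_cast hn
  set δ := s * q / n with hδ
  have hδ0 : 0 < δ := by have := hs.1; positivity
  set ω := unitBallVolume n with hω
  have hω0 : 0 < ω := unitBallVolume_pos n
  set G0 := ∫ x : Rn n, kernelMajorant s x with hG0
  have hG00 : 0 ≤ G0 := integral_nonneg fun x => kernelMajorant_nonneg s x
  set e : ℝ := (n : ℝ) + m with he
  have he0 : 0 < e := by positivity
  set C₁ : ℝ := 2 * ((4 * ((2 * m) ^ (m : ℝ) * G0) + 4 * (2 * (D + 1) ^ e * M)) * 4 ^ e) with hC₁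
  have hC₁0 : 0 ≤ C₁ := by positivity
  set C₃ : ℝ := 2 * 2 ^ P * 2 ^ (n : ℝ) / ω with hC₃
  have hC₃0 : 0 < C₃ := by positivity
  refine ⟨C₂ * C₁ + C₃ ^ δ, by positivity, (P * δ + e + P) + (n + P) * δ, by positivity, ?_⟩
  intro ρ g ℓ hg hgρ hρR hℓ hfin
  have hg1 : g ≤ 1 := by linarith
  set N := (P * δ + e + P) + (n + P) * δ with hN
  set X := 1 / g with hX
  have hX1 : 1 ≤ X := by rw [hX, le_div_iff₀ hg]; linarith
  have hX0 : 0 < X := by linarith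
  set a := (excessMass P w (ball x₀ ρ) ℓ).toReal with ha
  have haE : ENNReal.ofReal a = excessMass P w (ball x₀ ρ) ℓ := ENNReal.ofReal_toReal hfin
  have hmono : excessMass P w (ball x₀ (ρ - g)) (ℓ + g) ≤ ENNReal.ofReal a := by
    rw [haE]
    exact excessMass_mono hP0.le w (ball_subset_ball (by linarith)) (by linarith)
  have ha0 : 0 ≤ a := ENNReal.toReal_nonneg
  rcases ha0.eq_or_lt with ha' | hapos
  · rw [← ha'] at hmono ⊢
    rw [ENNReal.ofReal_zero, nonpos_iff_eq_zero] at hmono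
    rw [hmono, ENNReal.toReal_zero]
    positivity
  set v : Rn n → ℝ := fun x => excess (ℓ + g) (w x) with hv
  have hv0 : ∀ x, 0 ≤ v x := fun x => excess_nonneg _ _
  have hvm : Measurable v := (hw.1.sub_const _).max measurable_const
  have hem : Measurable fun x => excess ℓ (w x) := (hw.1.sub_const _).max measurable_const
  set S := X ^ P * a with hS
  have hS0 : 0 < S := by positivity
  have hcheb : ∀ l > 0, volume {y | y ∈ ball x₀ ρ ∧ l ≤ excess ℓ (w y)} ≤
      ENNReal.ofReal (a * l ^ (-P)) := fun l hl =>
    volume_setOf_le_le_of_setLIntegral_rpow_le hem hP0.le hl haE.ge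
  have hvol0 : volume {y | y ∈ ball x₀ ρ ∧ 0 < v y} ≤ ENNReal.ofReal S := by
    refine (measure_mono fun y hy => ?_).trans ((hcheb g hg).trans_eq ?_)
    · refine ⟨hy.1, ?_⟩
      have h := hy.2
      simp only [hv, excess, lt_max_iff, lt_irrefl, or_false] at h
      exact le_max_of_le_left (by linarith)
    · rw [hS, hX, one_div, Real.inv_rpow hg.le, Real.rpow_neg hg.le, mul_comm]
  have hvoll : ∀ l > 0, volume {y | y ∈ ball x₀ ρ ∧ l < v y} ≤
      ENNReal.ofReal (S * l ^ (-P)) := by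
    intro l hl
    refine (measure_mono fun y hy => ?_).trans ((hcheb l hl).trans (ENNReal.ofReal_le_ofReal ?_))
    · refine ⟨hy.1, ?_⟩
      have h := hy.2
      simp only [hv, excess, lt_max_iff, not_lt_of_gt hl, or_false] at h
      exact le_max_of_le_left (by linarith)
    · have : 1 ≤ X ^ P := Real.one_le_rpow hX1 hP0.le
      have : a ≤ S := by rw [hS]; nlinarith
      gcongr
  have hvint : ∫⁻ x in ball x₀ ρ, ENNReal.ofReal (v x ^ P) ≤ ENNReal.ofReal a := by
    rw [haE]
    exact excessMass_mono hP0.le w subset_rfl (by linarith)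
  obtain ⟨hV, hVle⟩ := lintegral_powerMajorant_le hvm hv0 ha0 hS0.le hvint hvol0
  have haS : a ≤ S := by
    have : 1 ≤ X ^ P := Real.one_le_rpow hX1 hP0.le
    rw [hS]; nlinarith
  have hXN : ∀ b ≤ N, X ^ b ≤ X ^ N := fun b hb => Real.rpow_le_rpow_of_exponent_le hX1 hb
  by_cases hcase : 2 * (2 ^ P * S) ≤ ω * (g / 2) ^ n
  · have hη := isCutoff_radial x₀ (ρ₃ := ρ - g / 2) (ρ₂ := ρ - g / 4) (by linarith) (by linarith)
    have hA := fun x (hx : x ∈ ball x₀ (ρ - g / 4)) =>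
      have hxR : x ∈ ball x₀ R := ball_subset_ball (by linarith) hx
      setLIntegral_tailIntegrand_le (B := ball x₀ ρ) hs hp hD (g := g / 4) (by linarith)
        (by linarith) measurableSet_ball (hRD x hxR) (fun y hy => by
          rw [mem_ball, not_lt] at hy
          rw [mem_ball] at hx
          have h1 := dist_triangle y x x₀
          rw [← dist_eq_norm, dist_comm]
          linarith) (htail x hxR)
    have hE := caccioppoli hn hs hpm hps hp hw (x₀ := x₀) (ρ := ρ) (ℓ := ℓ + g) (P := P)
      (by linarith) (by linarith)
      (fun φ h1 h2 h3 => hsub φ h1 h2 fun x hx => h3 x fun h =>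
        hx (ball_subset_ball (by linarith) h))
      hη (fun x hx => radial_cutoff_eq_one (by linarith) hx)
      (fun x hx y hy => (hpq x (ball_subset_ball hρR hx) y (ball_subset_ball hρR hy)).2)
      (by linarith) (by linarith) (by positivity) hA hV
    have hball : ball x₀ (ρ - g / 2) ⊆ ball x₀ ρ := ball_subset_ball (by linarith)
    have hG := hgain p v x₀ (ρ - g) (ρ - g / 2) (g / 2) S hvm hv0 hP0
      (fun x hx y hy => hpq x (ball_subset_ball hρR (hball hx)) y
        (ball_subset_ball hρR (hball hy)))
      (by linarith) (by linarith) (by linarith) hS0 hcase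
      ((measure_mono (Set.ofPred_subset_ofPred.2 fun y hy => ⟨hball hy.1, hy.2⟩)).trans hvol0)
      (fun l hl => (measure_mono (Set.ofPred_subset_ofPred.2 fun y hy => ⟨hball hy.1, hy.2⟩)).trans
        (hvoll l hl))
    have hc : (4 * ((2 * m) ^ (m : ℝ) * (1 / (ρ - g / 4 - (ρ - g / 2))) ^ (m : ℝ) * G0)
        + 4 * (2 * ((D + 1) / (g / 4)) ^ ((n : ℝ) + m) * M)) *
          ∫ x in ball x₀ ρ, powerMajorant P (v x) ≤ C₁ * X ^ (e + P) * a := by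
      have h1 : 1 / (ρ - g / 4 - (ρ - g / 2)) = 4 * X := by
        rw [show ρ - g / 4 - (ρ - g / 2) = g / 4 by ring, hX]; field_simp
      have h2 : (D + 1) / (g / 4) = (D + 1) * (4 * X) := by rw [hX]; field_simp
      have h3 : (4 * X) ^ (m : ℝ) ≤ (4 * X) ^ e :=
        Real.rpow_le_rpow_of_exponent_le (by linarith) (by linarith)
      rw [h1, h2, Real.mul_rpow (x := D + 1) (by linarith) (by positivity)]
      calc _ ≤ (4 * ((2 * m) ^ (m : ℝ) * (4 * X) ^ e * G0)
            + 4 * (2 * ((D + 1) ^ e * (4 * X) ^ e) * M)) * (2 * S) := by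
            refine mul_le_mul ?_ (by linarith)
              (integral_nonneg fun x => powerMajorant_nonneg (hv0 x)) (by positivity)
            gcongr
        _ = _ := by
            rw [Real.mul_rpow (x := 4) (by norm_num) hX0.le, Real.rpow_add hX0 e P, hC₁, hS]
            ring
    have hfinal : excessMass P w (ball x₀ (ρ - g)) (ℓ + g) ≤
        ENNReal.ofReal (C₂ * S ^ δ * (C₁ * X ^ (e + P) * a)) := by
      rw [ENNReal.ofReal_mul (by positivity)]
      exact hG.trans (mul_le_mul_right (hE.trans (ENNReal.ofReal_le_ofReal hc)) _)
    refine (ENNReal.toReal_mono ENNReal.ofReal_ne_top hfinal).trans ?_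
    rw [ENNReal.toReal_ofReal (by positivity)]
    have hSδ : S ^ δ = X ^ (P * δ) * a ^ δ := by
      rw [hS, Real.mul_rpow (by positivity) ha0, ← Real.rpow_mul hX0.le]
    calc C₂ * S ^ δ * (C₁ * X ^ (e + P) * a)
        = C₂ * C₁ * X ^ (P * δ + (e + P)) * a ^ (1 + δ) := by
          rw [hSδ, Real.rpow_add hX0 (P * δ), Real.rpow_add hapos, Real.rpow_one]; ring
      _ ≤ (C₂ * C₁ + C₃ ^ δ) * X ^ N * a ^ (1 + δ) := by
          have h1 : X ^ (P * δ + (e + P)) ≤ X ^ N := hXN _ (by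
            have : 0 ≤ (n + P) * δ := by positivity
            linarith)
          have h2 : C₂ * C₁ ≤ C₂ * C₁ + C₃ ^ δ := le_add_of_nonneg_right (by positivity)
          gcongr
  · rw [not_le] at hcase
    have hY : 1 ≤ C₃ * X ^ ((n : ℝ) + P) * a := by
      have h1 : (g / 2) ^ n = (2 ^ (n : ℝ) * X ^ (n : ℝ))⁻¹ := by
        rw [Real.rpow_natCast, Real.rpow_natCast, hX, div_pow, one_div, inv_pow, mul_inv, inv_inv]
        ring
      have hpos : 0 < 2 ^ (n : ℝ) * X ^ (n : ℝ) := by positivity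
      rw [h1, ← div_eq_mul_inv, div_lt_iff₀ hpos] at hcase
      have h2 : C₃ * X ^ ((n : ℝ) + P) * a =
          2 * (2 ^ P * S) * (2 ^ (n : ℝ) * X ^ (n : ℝ)) / ω := by
        rw [hC₃, Real.rpow_add hX0, hS]; ring
      rw [h2, le_div_iff₀ hω0]
      linarith
    have hYδ : 1 ≤ C₃ ^ δ * X ^ (((n : ℝ) + P) * δ) * a ^ δ := by
      have h := Real.one_le_rpow hY hδ0.le
      rwa [Real.mul_rpow (by positivity) ha0, Real.mul_rpow hC₃0.le (by positivity),
        ← Real.rpow_mul hX0.le] at h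
    refine (ENNReal.toReal_mono ENNReal.ofReal_ne_top hmono).trans ?_
    rw [ENNReal.toReal_ofReal ha0]
    calc a ≤ a * (C₃ ^ δ * X ^ (((n : ℝ) + P) * δ) * a ^ δ) := le_mul_of_one_le_right ha0 hYδ
      _ = C₃ ^ δ * X ^ (((n : ℝ) + P) * δ) * a ^ (1 + δ) := by
          rw [Real.rpow_add hapos, Real.rpow_one]; ring
      _ ≤ (C₂ * C₁ + C₃ ^ δ) * X ^ N * a ^ (1 + δ) := by
          have h1 : X ^ (((n : ℝ) + P) * δ) ≤ X ^ N := hXN _ (by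
            have : 0 ≤ P * δ + e + P := by positivity
            linarith)
          have h2 : C₃ ^ δ ≤ C₂ * C₁ + C₃ ^ δ := le_add_of_nonneg_left (by positivity)
          gcongr

lemma tendsto_excessMass_zero {n : ℕ} {P K : ℝ} (hP : 0 < P) {w : Rn n → ℝ} (hw : Measurable w)
    {B : Set (Rn n)} (h : excessMass P w B K ≠ ⊤) :
    Tendsto (fun k : ℕ => excessMass P w B k) atTop (𝓝 0) := by
  have hlim := tendsto_lintegral_filter_of_dominated_convergence (μ := volume.restrict B)
    (l := atTop) (F := fun (k : ℕ) x => ENNReal.ofReal (excess k (w x) ^ P)) (f := fun _ => 0)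
    (fun x => ENNReal.ofReal (excess K (w x) ^ P))
    (Eventually.of_forall fun k =>
      (((hw.sub_const _).max measurable_const).pow_const P).ennreal_ofReal)
    (by
      filter_upwards [eventually_ge_atTop ⌈K⌉₊] with k hk
      refine Eventually.of_forall fun x => ENNReal.ofReal_le_ofReal ?_
      exact Real.rpow_le_rpow (excess_nonneg _ _)
        (max_le_max (by linarith [Nat.ceil_le.1 hk]) le_rfl) hP.le)
    h
    (Eventually.of_forall fun x => by
      refine tendsto_const_nhds.congr' ?_
      filter_upwards [eventually_ge_atTop ⌈w x⌉₊] with k hk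
      have : excess k (w x) = 0 := max_eq_right (by linarith [Nat.ceil_le.1 hk])
      rw [this, Real.zero_rpow hP.ne', ENNReal.ofReal_zero])
  simpa [excessMass] using hlim

lemma exists_excessMass_le {n : ℕ} {P K ε : ℝ} (hP : 0 < P) {w : Rn n → ℝ} (hw : Measurable w)
    {B : Set (Rn n)} (h : excessMass P w B K ≠ ⊤) (hε : 0 < ε) :
    ∃ k : ℕ, K ≤ k ∧ excessMass P w B k ≤ ENNReal.ofReal ε := by
  have h1 := (tendsto_excessMass_zero hP hw h).eventually
    (ge_mem_nhds (ENNReal.ofReal_pos.2 hε))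
  obtain ⟨k, hk, hkK⟩ := (h1.and (eventually_ge_atTop ⌈K⌉₊)).exists
  exact ⟨k, Nat.ceil_le.1 hkK, hk⟩

/-- Higher integrability of the excess of a `W^{s,p}` function over a high level. -/
lemma exists_excessMass_ne_top {n : ℕ} (hn : 1 ≤ n) {s : ℝ} (hs : 0 < s)
    {p : Rn n → Rn n → ℝ} {w : Rn n → ℝ} (hw : MemW s p w) {x₀ : Rn n} {R P q : ℝ}
    (hR0 : 0 < R) (hR : R ≤ 1) (hp : ∀ x y, 1 < p x y)
    (hq : 0 < q) (hqP : q ≤ P) (hPt : P ≤ q + q * (s * q / n))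
    (hpq : ∀ x ∈ ball x₀ R, ∀ y ∈ ball x₀ R, q ≤ p x y ∧ p x y ≤ P) :
    ∃ K : ℝ, excessMass P w (ball x₀ (R / 2)) K ≠ ⊤ := by
  obtain ⟨C, -, hgain⟩ := setLIntegral_rpow_le_energy hn hs hq hq hPt
  have hω := unitBallVolume_pos n
  set S := unitBallVolume n * (R / 2) ^ n / (2 * 2 ^ q) with hS
  have hS0 : 0 < S := by positivity
  have hexm : ∀ ℓ, Measurable fun x => excess ℓ (w x) :=
    fun ℓ => (hw.1.sub_const _).max measurable_const
  have hq0 : excessMass q w (ball x₀ R) 0 ≠ ⊤ := by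
    refine ne_top_of_le_ne_top (b := ∫⁻ x in ball x₀ R, (1 + ENNReal.ofReal (|w x| ^ p x x))) ?_ ?_
    · rw [lintegral_add_left measurable_const, setLIntegral_one]
      exact ENNReal.add_ne_top.2 ⟨measure_ball_lt_top.ne,
        ne_top_of_le_ne_top hw.2.1.ne (setLIntegral_le_lintegral _ _)⟩
    · refine setLIntegral_mono' measurableSet_ball fun x hx => ?_
      rw [← ENNReal.ofReal_one, ← ENNReal.ofReal_add zero_le_one (by positivity)]
      refine ENNReal.ofReal_le_ofReal ?_
      have h1 : excess 0 (w x) ≤ |w x| := by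
        rw [excess, sub_zero]
        exact max_le (le_abs_self _) (abs_nonneg _)
      have h2 := rpow_le_rpow_add_ite (abs_nonneg (w x)) hq (hpq x hx x hx).1
      have h3 : (if 0 < |w x| then (1 : ℝ) else 0) ≤ 1 := by split_ifs <;> norm_num
      have h4 := Real.rpow_le_rpow (excess_nonneg _ _) h1 hq.le
      linarith
  obtain ⟨k, -, hk⟩ := exists_excessMass_le hq hw.1 hq0 hS0
  refine ⟨k + 1, ?_⟩
  set v : Rn n → ℝ := fun x => excess (k + 1) (w x) with hv
  have hcheb : ∀ l > 0, volume {y | y ∈ ball x₀ R ∧ l ≤ excess k (w y)} ≤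
      ENNReal.ofReal (S * l ^ (-q)) := fun l hl =>
    volume_setOf_le_le_of_setLIntegral_rpow_le (hexm k) hq.le hl hk
  have hG := hgain p v x₀ (R / 2) R (R / 2) S (hexm _) (fun x => excess_nonneg _ _)
    (by linarith) hpq (by linarith) (by linarith) (by linarith) hS0
    (le_of_eq (by rw [hS]; field_simp))
    (by
      refine (measure_mono (Set.ofPred_subset_ofPred.2 fun y hy => ⟨hy.1, ?_⟩)).trans
        ((hcheb 1 one_pos).trans_eq (by rw [Real.one_rpow, mul_one]))
      have h := hy.2
      simp only [hv, excess, lt_max_iff, lt_irrefl, or_false] at h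
      exact le_max_of_le_left (by linarith))
    (fun l hl => by
      refine (measure_mono (Set.ofPred_subset_ofPred.2 fun y hy => ⟨hy.1, ?_⟩)).trans (hcheb l hl)
      have h := hy.2
      simp only [hv, excess, lt_max_iff, not_lt_of_gt hl, or_false] at h
      exact le_max_of_le_left (by linarith))
  refine ne_top_of_le_ne_top (ENNReal.mul_ne_top ENNReal.ofReal_ne_top ?_) hG
  refine ne_top_of_le_ne_top hw.2.2.ne ?_
  refine (setLIntegral_le_lintegral _ _).trans (lintegral_mono fun x => ?_)
  refine (setLIntegral_le_lintegral _ _).trans (lintegral_mono fun y => ?_)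
  refine ENNReal.ofReal_le_ofReal ?_
  unfold energyDensity
  exact div_le_div_of_nonneg_right (Real.rpow_le_rpow (abs_nonneg _) (abs_excess_sub_le _ _ _)
    (zero_lt_one.trans (hp x y)).le) (by positivity)

/-- local boundedness from below of weak supersolutions. -/
theorem statement1 {n : ℕ} (hn : 1 ≤ n) (s : ℝ) (hs : s ∈ Set.Ioo (0:ℝ) 1)
    (p : Rn n → Rn n → ℝ) (hp : ExponentOK p)
    (Ω : Set (Rn n)) (hΩo : IsOpen Ω) (hΩb : Bornology.IsBounded Ω) (hΩne : Ω.Nonempty)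
    (u : Rn n → ℝ) (hu : MemW s p u) (hsuper : IsWeakSupersol s p Ω u)
    (htail : ∃ M : ℝ, ∀ x ∈ Ω,
      (∫⁻ y, ENNReal.ofReal ((max (-u y) 0) ^ (p x y - 1) / (1 + ‖y‖ ^ ((n : ℝ) + s * p x y))))
        ≤ ENNReal.ofReal M) :
    ∀ x₀ ∈ Ω, ∃ r > 0, ball x₀ r ⊆ Ω ∧
      ∃ m : ℝ, ∀ᵐ x, x ∈ ball x₀ r → m ≤ u x := by
  intro x₀ hx₀
  obtain ⟨hpc, hps, pm, pM, hpm1, hpM⟩ := hp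
  obtain ⟨M, hM⟩ := htail
  obtain ⟨D, hD⟩ := hΩb.exists_norm_le
  have hpm := hpc.measurable
  have hp1 : ∀ x y, 1 < p x y := fun x y => hpm1.trans_le (hpM x y).1
  have hpm' : ∀ x y, 1 < p x y ∧ p x y ≤ ⌈pM⌉₊ := fun x y =>
    ⟨hp1 x y, (hpM x y).2.trans (Nat.le_ceil _)⟩
  have hn0 : (0 : ℝ) < n := by exact_mod_cast hn
  have hs0 := hs.1
  -- exponents close to `p x₀ x₀`
  set ε := min ((p x₀ x₀ - 1) / 2) (s / (2 * n)) with hε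
  have hε0 : 0 < ε := lt_min (by linarith [hp1 x₀ x₀]) (by positivity)
  set q := p x₀ x₀ - ε with hq
  set P := p x₀ x₀ + ε with hP
  have hq1 : 1 < q := by
    have := min_le_left ((p x₀ x₀ - 1) / 2) (s / (2 * n))
    linarith [hp1 x₀ x₀]
  have hqP : q ≤ P := by linarith
  have hδ0 : 0 < s * q / n := by positivity
  have hPq : P ≤ q + q * (s * q / n) := by
    have h1 : ε ≤ s / (2 * n) := min_le_right _ _
    have h2 : 2 * (s / (2 * n)) ≤ q * (s * q / n) := by
      rw [show 2 * (s / (2 * n)) = s / n by field_simp, mul_div_assoc',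
        div_le_div_iff_of_pos_right hn0]
      have h3 : 1 ≤ q * q := by nlinarith
      nlinarith
    linarith
  obtain ⟨r₁, hr₁, hr₁Ω⟩ := Metric.isOpen_iff.1 hΩo x₀ hx₀
  obtain ⟨r₂, hr₂, hr₂p⟩ := Metric.continuous_iff.1 hpc (x₀, x₀) ε hε0
  set R₀ := min (min r₁ r₂) 1 with hR₀
  have hR₀0 : 0 < R₀ := lt_min (lt_min hr₁ hr₂) one_pos
  have hR₀1 : R₀ ≤ 1 := min_le_right _ _
  have hR₀Ω : ball x₀ R₀ ⊆ Ω :=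
    (ball_subset_ball ((min_le_left _ _).trans (min_le_left _ _))).trans hr₁Ω
  have hpq : ∀ x ∈ ball x₀ R₀, ∀ y ∈ ball x₀ R₀, q ≤ p x y ∧ p x y ≤ P := by
    intro x hx y hy
    have hR₂ : R₀ ≤ r₂ := (min_le_left _ _).trans (min_le_right _ _)
    have h := hr₂p (x, y) (by
      rw [Prod.dist_eq]
      exact max_lt ((mem_ball.1 hx).trans_le hR₂) ((mem_ball.1 hy).trans_le hR₂))
    rw [Real.dist_eq, abs_lt] at h
    simp only at h
    constructor <;> linarith
  set w : Rn n → ℝ := fun x => -u x with hw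
  have hwW : MemW s p w := hu.neg
  set R := R₀ / 2 with hR
  have hR0 : 0 < R := by positivity
  have hRR₀ : ball x₀ R ⊆ ball x₀ R₀ := ball_subset_ball (by linarith)
  obtain ⟨K₁, hK₁⟩ := exists_excessMass_ne_top hn hs0 hwW hR₀0 hR₀1 hp1 (by linarith) hqP hPq hpq
  obtain ⟨C, hC, N, hN, hstep⟩ := excessMass_step hn hs hpm hps hpm' hwW (x₀ := x₀) (R := R)
    (P := P) (q := q) (D := max D 1) (M := max M 0) (by linarith)
    (fun φ h1 h2 h3 => hsuper.integral_weakIntegrand_neg_nonpos hpm hp1 hu h1 h2 fun x hx =>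
      h3 x fun h => hx (hR₀Ω (hRR₀ h)))
    hq1 hqP (hPq.trans (by gcongr)) (fun x hx y hy => hpq x (hRR₀ hx) y (hRR₀ hy))
    (le_max_right _ _) (fun x hx => (hD x (hR₀Ω (hRR₀ hx))).trans (le_max_left _ _))
    (le_max_right _ _)
    (fun x hx => (hM x (hR₀Ω (hRR₀ hx))).trans (ENNReal.ofReal_le_ofReal (le_max_left _ _)))
  have hP0 : 0 < P := by linarith
  obtain ⟨κ, hκ, hiter⟩ := iteration_to_zero hC hN hδ0 (τ₀ := R / 2) (by linarith)
  obtain ⟨k, hkK, hk⟩ := exists_excessMass_le hP0 hwW.1 hK₁ hκ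
  have hfin : ∀ τ, 0 ≤ τ → excessMass P w (ball x₀ (R - τ)) (k + τ) ≠ ⊤ := fun τ hτ =>
    ne_top_of_le_ne_top hK₁ (excessMass_mono hP0.le w (ball_subset_ball (by linarith))
      (by linarith))
  have hzero := hiter
    (fun τ => (excessMass P w (ball x₀ (R - max τ 0)) (k + max τ 0)).toReal)
    (fun τ => ENNReal.toReal_nonneg)
    (fun τ τ' h => ENNReal.toReal_mono (hfin _ (le_max_right _ _)) (by
      have := max_le_max_right 0 h
      exact excessMass_mono hP0.le w (ball_subset_ball (by linarith)) (by linarith)))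
    (fun τ g hτ hg hτg => by
      have h := hstep (R - τ) g (k + τ) hg (by linarith) (by linarith) (by positivity) (hfin τ hτ)
      rw [max_eq_left hτ, max_eq_left (by linarith : 0 ≤ τ + g), ← add_assoc, ← sub_sub]
      exact h)
    (by
      simp only [max_self, sub_zero, add_zero]
      exact ENNReal.toReal_le_of_le_ofReal hκ.le hk)
  have hR2 : 0 ≤ R / 2 := by linarith
  simp only [max_eq_left hR2] at hzero
  have hem : Measurable fun x => excess (k + R / 2) (w x) :=
    (hwW.1.sub_const _).max measurable_const
  rw [ENNReal.toReal_eq_zero_iff, or_iff_left (hfin _ hR2), excessMass,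
    lintegral_eq_zero_iff (hem.pow_const P).ennreal_ofReal, EventuallyEq,
    ae_restrict_iff' measurableSet_ball] at hzero
  refine ⟨R - R / 2, by linarith,
    (ball_subset_ball (by linarith)).trans hR₀Ω, -(k + R / 2), ?_⟩
  filter_upwards [hzero] with x hx hxB
  have h := hx hxB
  rw [Pi.zero_apply, ENNReal.ofReal_eq_zero] at h
  by_contra! hlt
  have hpos : 0 < excess (k + R / 2) (w x) := lt_max_of_lt_left (by simp only [hw]; linarith)
  exact absurd (Real.rpow_pos_of_pos hpos P) (not_lt.2 h)
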